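/- Let M be a smooth n-dimensional hypersurface of R^{n+1}. For every φ ∈ C^1_c(M), (∫_M |φ|^{n/(n−1)} dV)^{(n−1)/n} ≤ C ∫_M (|∇_T φ| + |H φ|) dV, where C depends only on n. -/

import Mathlib

open MeasureTheory
open scoped RealInnerProductSpace

noncomputable section

/-- Ambient Euclidean space `ℝ^{n+1}`. -/
abbrev Eu (n : ℕ) := EuclideanSpace ℝ (Fin (n + 1))

/-- A smooth `n`-dimensional hypersurface of `ℝ^{n+1}`, described by its carrier set
together with a smooth unit normal field; locally it is a regular level set of a
smooth function. -/
structure Hypersurface (n : ℕ) where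
  carrier : Set (Eu n)
  nu : Eu n → Eu n
  smooth_nu : ContDiff ℝ (⊤ : ℕ∞) nu
  unit_nu : ∀ x ∈ carrier, ‖nu x‖ = 1
  locally_level_set : ∀ x ∈ carrier, ∃ U : Set (Eu n), IsOpen U ∧ x ∈ U ∧
    ∃ f : Eu n → ℝ, ContDiff ℝ (⊤ : ℕ∞) f ∧
      carrier ∩ U = {y ∈ U | f y = 0} ∧
      (∀ y ∈ U, gradient f y ≠ 0) ∧
      (∀ y ∈ carrier ∩ U, nu y = ‖gradient f y‖⁻¹ • gradient f y)

variable {n : ℕ}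

/-- The `i`-th tangential derivative `δ_i φ = ∂_i φ − ν^i ∑_j (∂_j φ) ν^j`. -/
def tderiv (ν : Eu n → Eu n) (i : Fin (n + 1)) (φ : Eu n → ℝ) (x : Eu n) : ℝ :=
  fderiv ℝ φ x (EuclideanSpace.single i 1)
    - ν x i * ∑ j, fderiv ℝ φ x (EuclideanSpace.single j 1) * ν x j

/-- The tangential gradient `∇_T φ = ∇φ − (∇φ·ν)ν`. -/
def tgrad (ν : Eu n → Eu n) (φ : Eu n → ℝ) (x : Eu n) : Eu n :=
  gradient φ x - ⟪gradient φ x, ν x⟫ • ν x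

/-- The tangential divergence `div_T Z = ∑ i δ_i Z^i`. -/
def tdiv (ν : Eu n → Eu n) (Z : Eu n → Eu n) (x : Eu n) : ℝ :=
  ∑ i, tderiv ν i (fun y => Z y i) x

/-- The mean curvature `H = div_T ν` (sum of the principal curvatures). -/
def meanCurv (M : Hypersurface n) (x : Eu n) : ℝ := tdiv M.nu M.nu x

/-- The Laplace–Beltrami operator `Δφ = div_T (∇_T φ)`. -/
def lapBel (ν : Eu n → Eu n) (φ : Eu n → ℝ) (x : Eu n) : ℝ := tdiv ν (tgrad ν φ) x

/-- The surface measure on `M`: the `n`-dimensional Hausdorff measure restricted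
to the carrier of `M`. -/
def surfMeasure (M : Hypersurface n) : Measure (Eu n) :=
  (μH[(n : ℝ)]).restrict M.carrier

/-- `C^1` functions with compact support in a set `S`: ambient `C^1` functions
vanishing on `S` outside a compact subset `K ⊆ S`. -/
def C1cOn (S : Set (Eu n)) (φ : Eu n → ℝ) : Prop :=
  ContDiff ℝ 1 φ ∧ ∃ K : Set (Eu n), IsCompact K ∧ K ⊆ S ∧ ∀ x ∈ S, x ∉ K → φ x = 0

abbrev En (n : ℕ) := EuclideanSpace ℝ (Fin n)

/-- A frame: an isometric embedding of `ℝⁿ` onto the orthogonal complement of `ν0`. -/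
structure IsFrame (L : En n →ₗᵢ[ℝ] Eu n) (ν0 : Eu n) : Prop where
  unit : ‖ν0‖ = 1
  orth : ∀ w, ⟪L w, ν0⟫ = 0
  surj : ∀ x, ⟪x, ν0⟫ = 0 → ∃ w, L w = x

lemma exists_frame (ν0 : Eu n) (h : ‖ν0‖ = 1) : ∃ L : En n →ₗᵢ[ℝ] Eu n, IsFrame L ν0 := by
  have h0 : ν0 ≠ 0 := by rintro rfl; simp at h
  have : Fact (Module.finrank ℝ (Eu n) = n + 1) := ⟨by simp⟩
  have hr : Module.finrank ℝ (ℝ ∙ ν0)ᗮ = n := Submodule.finrank_orthogonal_span_singleton h0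
  let b := (stdOrthonormalBasis ℝ (ℝ ∙ ν0)ᗮ).reindex (finCongr hr)
  refine ⟨(ℝ ∙ ν0)ᗮ.subtypeₗᵢ.comp b.repr.symm.toLinearIsometry, h, fun w => ?_, fun x hx => ?_⟩
  · have := (b.repr.symm w).2
    rw [Submodule.mem_orthogonal_singleton_iff_inner_left] at this
    simpa using this
  · refine ⟨b.repr ⟨x, ?_⟩, by simp⟩
    rw [Submodule.mem_orthogonal_singleton_iff_inner_left]; exact hx

lemma hausdorff_image_le_of_dist {X Y Z : Type*} [MetricSpace X] [MeasurableSpace X] [BorelSpace X]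
    [MetricSpace Y] [MeasurableSpace Y] [BorelSpace Y] (p : Z → X) (q : Z → Y) (S : Set Z)
    (K : NNReal) (h : ∀ x ∈ S, ∀ y ∈ S, dist (p x) (p y) ≤ K * dist (q x) (q y)) (d : ℝ)
    (hd : 0 ≤ d) :
    μH[d] (p '' S) ≤ (K : ENNReal) ^ d * μH[d] (q '' S) := by
  classical
  rcases S.eq_empty_or_nonempty with rfl | hS
  · simp
  have : Nonempty Z := ⟨hS.some⟩
  have hc : ∀ y ∈ q '' S, ∃ x ∈ S, q x = y := fun y hy => hy
  choose! r hr1 hr2 using hc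
  have hl : LipschitzOnWith K (p ∘ r) (q '' S) := by
    refine LipschitzOnWith.of_dist_le_mul fun y hy z hz => ?_
    have := h (r y) (hr1 y hy) (r z) (hr1 z hz)
    rwa [hr2 y hy, hr2 z hz] at this
  have : p '' S ⊆ (p ∘ r) '' (q '' S) := by
    rintro _ ⟨x, hx, rfl⟩
    refine ⟨q x, ⟨x, hx, rfl⟩, ?_⟩
    have hm : q x ∈ q '' S := ⟨x, hx, rfl⟩
    have := h (r (q x)) (hr1 _ hm) x hx
    rw [hr2 _ hm, dist_self, mul_zero] at this
    exact dist_le_zero.1 this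
  exact (measure_mono this).trans (hl.hausdorffMeasure_image_le hd)

/-- Derivative of the graph map. -/
def grA (L : En n →ₗᵢ[ℝ] Eu n) (ν0 : Eu n) (a : En n) : En n →L[ℝ] Eu n :=
  L.toContinuousLinearMap + (innerSL ℝ a).smulRight ν0

lemma grA_apply (L : En n →ₗᵢ[ℝ] Eu n) (ν0 : Eu n) (a w : En n) :
    grA L ν0 a w = L w + ⟪a, w⟫ • ν0 := by simp [grA]

lemma grA_inner {L : En n →ₗᵢ[ℝ] Eu n} {ν0 : Eu n} (h : IsFrame L ν0) (a v w : En n) :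
    ⟪grA L ν0 a v, grA L ν0 a w⟫ = ⟪v, w⟫ + ⟪a, v⟫ * ⟪a, w⟫ := by
  have h1 := h.orth v
  have h2 : ⟪ν0, L w⟫ = 0 := by rw [real_inner_comm]; exact h.orth w
  simp only [grA_apply, inner_add_left, inner_add_right, inner_smul_left, inner_smul_right, h1, h2,
    L.inner_map_map, real_inner_self_eq_norm_sq, h.unit]
  simp; ring

set_option maxHeartbeats 800000 in
lemma lin_area {L : En n →ₗᵢ[ℝ] Eu n} {ν0 : Eu n} (h : IsFrame L ν0) (a : En n) (S : Set (En n)) :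
    μH[(n : ℝ)] (grA L ν0 a '' S) = ENNReal.ofReal (Real.sqrt (1 + ‖a‖ ^ 2)) * μH[(n : ℝ)] S := by
  set W := Real.sqrt (1 + ‖a‖ ^ 2)
  have hW : 0 < W := Real.sqrt_pos.2 (by positivity)
  have hW2 : W ^ 2 = 1 + ‖a‖ ^ 2 := Real.sq_sqrt (by positivity)
  -- unit normal
  set N : Eu n := W⁻¹ • (ν0 - L a)
  have hN : ‖N‖ = 1 := by
    have : ‖ν0 - L a‖ ^ 2 = W ^ 2 := by
      rw [norm_sub_sq_real, h.unit, real_inner_comm, h.orth, L.norm_map, hW2]; ring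
    have h2 : ‖ν0 - L a‖ = W := by
      rwa [sq_eq_sq₀ (norm_nonneg _) hW.le] at this
    simp [N, norm_smul, h2, abs_of_pos hW, hW.ne']
  obtain ⟨R, hR⟩ := exists_frame N hN
  have horth : ∀ w, ⟪grA L ν0 a w, N⟫ = 0 := by
    intro w
    have h2 : ⟪ν0, L a⟫ = 0 := by rw [real_inner_comm]; exact h.orth a
    simp only [N, grA_apply, inner_add_left, inner_smul_right, inner_smul_left, inner_sub_right,
      h.orth, L.inner_map_map, h2, real_inner_self_eq_norm_sq, h.unit]
    rw [real_inner_comm w a]; simp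
  choose B0 hB0 using fun w => hR.surj _ (horth w)
  let B : En n →ₗ[ℝ] En n :=
    { toFun := B0
      map_add' := fun x y => R.injective (by simp [hB0])
      map_smul' := fun c x => R.injective (by simp [hB0]) }
  have hB : ∀ w, R (B w) = grA L ν0 a w := hB0
  have himg : grA L ν0 a '' S = R '' (B '' S) := by
    rw [Set.image_image]; exact Set.image_congr fun w _ => (hB w).symm
  rw [himg, R.isometry.hausdorffMeasure_image (Or.inl (by positivity)),
    Measure.addHaar_image_linearMap]
  congr 2
  have hBin : ∀ v w, ⟪B v, B w⟫ = ⟪v, w⟫ + ⟪a, v⟫ * ⟪a, w⟫ := by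
    intro v w; rw [← R.inner_map_map, hB, hB, grA_inner h]
  let b := (EuclideanSpace.basisFun (Fin n) ℝ)
  let T := LinearMap.toMatrix b.toBasis b.toBasis B
  have hT : T.transpose * T = 1 + Matrix.replicateCol Unit (fun i => a i) *
      Matrix.replicateRow Unit (fun i => a i) := by
    ext i j
    have h1 := hBin (b i) (b j)
    have h2 : ⟪b i, b j⟫ = (1 : Matrix (Fin n) (Fin n) ℝ) i j := by
      rw [orthonormal_iff_ite.1 b.orthonormal]; rfl
    have h3 : ∀ i, ⟪a, b i⟫ = a i := by intro i; simp [b, EuclideanSpace.inner_single_right]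
    rw [h2, h3, h3] at h1
    rw [Matrix.mul_apply, Matrix.add_apply, Matrix.mul_apply]
    simp only [Matrix.transpose_apply, Matrix.replicateCol_apply, Matrix.replicateRow_apply,
      Finset.univ_unique, Finset.sum_singleton]
    rw [← h1, PiLp.inner_apply]
    refine Finset.sum_congr rfl fun k _ => ?_
    have e1 : ∀ i, T k i = B (b i) k := by
      intro i; simp [T, LinearMap.toMatrix_apply, b]
    rw [e1, e1]; simp [mul_comm]
  have hdet : LinearMap.det B ^ 2 = W ^ 2 := by
    rw [← LinearMap.det_toMatrix b.toBasis B, sq]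
    have := congrArg Matrix.det hT
    rw [Matrix.det_mul, Matrix.det_transpose, Matrix.det_one_add_replicateCol_mul_replicateRow] at this
    rw [this, hW2, EuclideanSpace.norm_sq_eq]
    simp [dotProduct, sq]
  rw [sq_eq_sq_iff_abs_eq_abs, abs_of_pos hW] at hdet
  exact hdet

lemma inner_grad {E : Type*} [NormedAddCommGroup E] [InnerProductSpace ℝ E] [CompleteSpace E]
    (g : E → ℝ) (y w : E) : ⟪gradient g y, w⟫ = fderiv ℝ g y w := by
  simp [gradient]

/-- The graph map. -/
def gr (L : En n →ₗᵢ[ℝ] Eu n) (ν0 ξ : Eu n) (g : En n → ℝ) (y : En n) : Eu n :=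
  ξ + L y + g y • ν0

lemma frame_norm {L : En n →ₗᵢ[ℝ] Eu n} {ν0 : Eu n} (h : IsFrame L ν0) (w : En n) (t : ℝ) :
    ‖L w + t • ν0‖ ^ 2 = ‖w‖ ^ 2 + t ^ 2 := by
  rw [norm_add_sq_real, inner_smul_right, h.orth, norm_smul, h.unit, L.norm_map]
  simp

lemma frame_norm_le {L : En n →ₗᵢ[ℝ] Eu n} {ν0 : Eu n} (h : IsFrame L ν0) (w : En n) (t : ℝ) :
    ‖w‖ ≤ ‖L w + t • ν0‖ := by
  refine (sq_le_sq₀ (norm_nonneg _) (norm_nonneg _)).1 ?_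
  rw [frame_norm h]; nlinarith [sq_nonneg t]

lemma gr_sub (L : En n →ₗᵢ[ℝ] Eu n) (ν0 ξ : Eu n) (g : En n → ℝ) (y z : En n) :
    gr L ν0 ξ g y - gr L ν0 ξ g z = L (y - z) + (g y - g z) • ν0 := by
  simp only [gr, map_sub, sub_smul]; abel

lemma gr_antilip {L : En n →ₗᵢ[ℝ] Eu n} {ν0 : Eu n} (h : IsFrame L ν0) (ξ : Eu n) (g : En n → ℝ)
    (y z : En n) : dist y z ≤ dist (gr L ν0 ξ g y) (gr L ν0 ξ g z) := by
  rw [dist_eq_norm, dist_eq_norm, gr_sub]; exact frame_norm_le h _ _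

lemma gr_embedding {L : En n →ₗᵢ[ℝ] Eu n} {ν0 : Eu n} (h : IsFrame L ν0) (ξ : Eu n) {g : En n → ℝ}
    {K : NNReal} (hg : LipschitzWith K g) : Topology.IsClosedEmbedding (gr L ν0 ξ g) := by
  refine AntilipschitzWith.isClosedEmbedding (K := 1) (AntilipschitzWith.of_le_mul_dist fun y z => ?_) ?_
  · simpa using gr_antilip h ξ g y z
  · have h1 : LipschitzWith (0 + 1 + K * 1) (gr L ν0 ξ g) := by
      refine ((LipschitzWith.const ξ).add L.lipschitz).add ?_
      refine LipschitzWith.of_dist_le_mul fun y z => ?_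
      rw [dist_eq_norm, ← sub_smul, norm_smul, h.unit, ← dist_eq_norm, mul_one, mul_one]
      exact hg.dist_le_mul y z
    exact h1.uniformContinuous

def grW (g : En n → ℝ) (y : En n) : ℝ := Real.sqrt (1 + ‖gradient g y‖ ^ 2)

lemma area_local {L : En n →ₗᵢ[ℝ] Eu n} {ν0 : Eu n} (h : IsFrame L ν0) (ξ : Eu n) {g : En n → ℝ}
    (hg : ContDiff ℝ 1 g) (y : En n) (K : NNReal) (hK : 1 < K) :
    ∃ s ∈ nhds y, ∀ S ⊆ s,
      μH[(n : ℝ)] (gr L ν0 ξ g '' S) ≤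
        (K : ENNReal) ^ (n : ℝ) * (ENNReal.ofReal (grW g y) * μH[(n : ℝ)] S) ∧
      ENNReal.ofReal (grW g y) * μH[(n : ℝ)] S ≤
        (K : ENNReal) ^ (n : ℝ) * μH[(n : ℝ)] (gr L ν0 ξ g '' S) := by
  have hs : HasStrictFDerivAt g (fderiv ℝ g y) y := hg.contDiffAt.hasStrictFDerivAt (by simp)
  obtain ⟨s, hsy, happ⟩ := hs.approximates_deriv_on_nhds (c := K - 1)
    (Or.inr (tsub_pos_of_lt hK))
  have hKc : ((K - 1 : NNReal) : ℝ) = K - 1 := by rw [NNReal.coe_sub hK.le]; simp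
  have key : ∀ x ∈ s, ∀ z ∈ s,
      ‖(gr L ν0 ξ g x - gr L ν0 ξ g z) - grA L ν0 (gradient g y) (x - z)‖ ≤ (K - 1) * ‖x - z‖ := by
    intro x hx z hz
    have := happ x hx z hz
    rw [hKc] at this
    rw [gr_sub, grA_apply, inner_grad, add_sub_add_left_eq_sub, ← sub_smul, norm_smul, h.unit, mul_one]
    exact this
  have hK1 : (0 : ℝ) ≤ K - 1 := by rw [← hKc]; positivity
  refine ⟨s, hsy, fun S hS => ?_⟩
  rw [grW, ← lin_area h]
  constructor
  · refine hausdorff_image_le_of_dist _ _ S K ?_ _ (by positivity)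
    intro x hx z hz
    have h1 := key x (hS hx) z (hS hz)
    have h2 : ‖x - z‖ ≤ ‖grA L ν0 (gradient g y) (x - z)‖ := by
      rw [grA_apply]; exact frame_norm_le h _ _
    rw [dist_eq_norm, dist_eq_norm, ← map_sub]
    have h3 := norm_sub_norm_le (gr L ν0 ξ g x - gr L ν0 ξ g z) (grA L ν0 (gradient g y) (x - z))
    nlinarith
  · refine hausdorff_image_le_of_dist _ _ S K ?_ _ (by positivity)
    intro x hx z hz
    have h1 := key x (hS hx) z (hS hz)
    have h2 : ‖x - z‖ ≤ ‖gr L ν0 ξ g x - gr L ν0 ξ g z‖ := by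
      rw [gr_sub]; exact frame_norm_le h _ _
    rw [dist_eq_norm, dist_eq_norm, ← map_sub]
    have h3 := norm_sub_norm_le (grA L ν0 (gradient g y) (x - z)) (gr L ν0 ξ g x - gr L ν0 ξ g z)
    rw [norm_sub_rev] at h1
    nlinarith

lemma area_formula {L : En n →ₗᵢ[ℝ] Eu n} {ν0 : Eu n} (h : IsFrame L ν0) (ξ : Eu n) {g : En n → ℝ}
    (hg : ContDiff ℝ 1 g) {C : NNReal} (hC : LipschitzWith C g) :
    (μH[(n : ℝ)] : Measure (Eu n)).comap (gr L ν0 ξ g) =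
      (μH[(n : ℝ)] : Measure (En n)).withDensity (fun y => ENNReal.ofReal (grW g y)) := by
  have hme : MeasurableEmbedding (gr L ν0 ξ g) := (gr_embedding h ξ hC).measurableEmbedding
  set ρ := (μH[(n : ℝ)] : Measure (Eu n)).comap (gr L ν0 ξ g) with hρ
  set lam := (μH[(n : ℝ)] : Measure (En n)) with hlam
  have hle : ∀ S, ρ S ≤ ((1 + C : NNReal) : ENNReal) ^ (n : ℝ) * lam S := by
    intro S
    rw [hρ, hme.comap_apply]
    have := hausdorff_image_le_of_dist (gr L ν0 ξ g) id S (1 + C) ?_ n (by positivity)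
    · simpa using this
    intro x _ z _
    rw [dist_eq_norm, gr_sub]
    refine (norm_add_le _ _).trans ?_
    rw [L.norm_map, norm_smul, h.unit, mul_one]
    have := hC.dist_le_mul x z
    rw [dist_eq_norm] at this
    simp only [NNReal.coe_add, NNReal.coe_one, id, dist_eq_norm] at this ⊢
    linarith
  have hac : ρ ≪ lam := by
    intro S hS
    have := hle S
    rw [hS, mul_zero] at this
    exact le_antisymm this bot_le
  have hKtop : ∀ K : NNReal, ((K : NNReal) : ENNReal) ^ (n : ℝ) ≠ ⊤ := fun K =>
    ENNReal.rpow_ne_top_of_nonneg (by positivity) (by simp)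
  have hlf : IsLocallyFiniteMeasure ρ := by
    refine ⟨fun x => ⟨Metric.closedBall x 1, Metric.closedBall_mem_nhds x one_pos, ?_⟩⟩
    refine (hle _).trans_lt (ENNReal.mul_lt_top (hKtop _).lt_top ?_)
    exact (isCompact_closedBall x 1).measure_lt_top
  rw [← Measure.withDensity_rnDeriv_eq ρ lam hac]
  refine withDensity_congr_ae ?_
  filter_upwards [Besicovitch.ae_tendsto_rnDeriv ρ lam] with y hy
  have hev : ∀ K : NNReal, 1 < K → ρ.rnDeriv lam y ≤ (K : ENNReal) ^ (n : ℝ) * ENNReal.ofReal (grW g y) ∧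
      ENNReal.ofReal (grW g y) ≤ (K : ENNReal) ^ (n : ℝ) * ρ.rnDeriv lam y := by
    intro K hK
    obtain ⟨s, hs, hS⟩ := area_local h ξ hg y K hK
    obtain ⟨ε, hε, hball⟩ := Metric.nhds_basis_closedBall.mem_iff.1 hs
    have hsub : ∀ᶠ r in nhdsWithin (0 : ℝ) (Set.Ioi 0), 0 < r ∧ Metric.closedBall y r ⊆ s := by
      filter_upwards [Ioc_mem_nhdsGT hε] with r hr
      exact ⟨hr.1, (Metric.closedBall_subset_closedBall hr.2).trans hball⟩
    have hne : ∀ r, 0 < r → lam (Metric.closedBall y r) ≠ 0 ∧ lam (Metric.closedBall y r) ≠ ⊤ :=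
      fun r hr => ⟨(Metric.measure_closedBall_pos _ _ hr).ne',
        (isCompact_closedBall y r).measure_lt_top.ne⟩
    constructor
    · refine le_of_tendsto hy ?_
      filter_upwards [hsub] with r hr
      refine ENNReal.div_le_of_le_mul ?_
      have := (hS _ hr.2).1
      rw [← hme.comap_apply] at this
      rwa [mul_assoc]
    · refine ge_of_tendsto (ENNReal.Tendsto.const_mul hy (Or.inr (hKtop K))) ?_
      filter_upwards [hsub] with r hr
      have := (hS _ hr.2).2
      rw [← hme.comap_apply] at this
      rw [← mul_div_assoc]
      rwa [ENNReal.le_div_iff_mul_le (Or.inl (hne r hr.1).1) (Or.inl (hne r hr.1).2)]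
  have hlim : Filter.Tendsto (fun K : NNReal => (K : ENNReal) ^ (n : ℝ)) (nhdsWithin 1 (Set.Ioi 1))
      (nhds 1) := by
    have h1 : Filter.Tendsto (fun K : NNReal => (K : ENNReal) ^ (n : ℝ)) (nhds 1)
      (nhds (((1 : NNReal) : ENNReal) ^ (n : ℝ))) :=
      ((ENNReal.continuous_rpow_const).comp ENNReal.continuous_coe).tendsto 1
    simp only [ENNReal.coe_one, ENNReal.one_rpow] at h1
    exact h1.mono_left nhdsWithin_le_nhds
  have hself : ∀ᶠ K : NNReal in nhdsWithin 1 (Set.Ioi 1), 1 < K := self_mem_nhdsWithin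
  apply le_antisymm
  · have := ENNReal.Tendsto.mul_const (b := ENNReal.ofReal (grW g y)) hlim (Or.inl one_ne_zero)
    rw [one_mul] at this
    exact ge_of_tendsto this (hself.mono fun K hK => (hev K hK).1)
  · have := ENNReal.Tendsto.mul_const (b := ρ.rnDeriv lam y) hlim (Or.inl one_ne_zero)
    rw [one_mul] at this
    exact ge_of_tendsto this (hself.mono fun K hK => (hev K hK).2)

/-- Divergence on `ℝⁿ`. -/
def divE (Z : En n → En n) (y : En n) : ℝ :=
  ∑ i, ⟪fderiv ℝ Z y (EuclideanSpace.basisFun (Fin n) ℝ i), EuclideanSpace.basisFun (Fin n) ℝ i⟫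

lemma divE_smul {v : En n → ℝ} {Z : En n → En n} {y : En n} (hv : DifferentiableAt ℝ v y)
    (hZ : DifferentiableAt ℝ Z y) :
    divE (fun y => v y • Z y) y = v y * divE Z y + fderiv ℝ v y (Z y) := by
  set b := EuclideanSpace.basisFun (Fin n) ℝ with hb
  have h1 : fderiv ℝ (fun y => v y • Z y) y = v y • fderiv ℝ Z y + (fderiv ℝ v y).smulRight (Z y) :=
    fderiv_fun_smul hv hZ
  have h2 : fderiv ℝ v y (Z y) = ∑ i, ⟪b i, Z y⟫ * fderiv ℝ v y (b i) := by
    conv_lhs => rw [← b.sum_repr' (Z y)]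
    rw [map_sum]; simp
  rw [divE, divE, h1, h2, Finset.mul_sum, ← Finset.sum_add_distrib]
  refine Finset.sum_congr rfl fun i _ => ?_
  simp only [_root_.add_apply, _root_.smul_apply,
    ContinuousLinearMap.smulRight_apply, inner_add_left, real_inner_smul_left, ← hb]
  rw [real_inner_comm (Z y)]
  ring

lemma divE_add {Y Z : En n → En n} {y : En n} (hv : DifferentiableAt ℝ Y y)
    (hZ : DifferentiableAt ℝ Z y) :
    divE (fun y => Y y + Z y) y = divE Y y + divE Z y := by
  rw [divE, divE, divE, fderiv_fun_add hv hZ, ← Finset.sum_add_distrib]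
  refine Finset.sum_congr rfl fun i _ => ?_
  simp [inner_add_left]

lemma divE_const (c : En n) (y : En n) : divE (fun _ => c) y = 0 := by
  simp [divE]

lemma integral_divE {Z : En n → En n} (hZ : ContDiff ℝ 1 Z) (hc : HasCompactSupport Z) :
    ∫ y, divE Z y ∂(μH[(n : ℝ)] : Measure (En n)) = 0 := by
  have hcf : HasCompactSupport (fderiv ℝ Z) := hc.fderiv (𝕜 := ℝ)
  have hcont : Continuous (fderiv ℝ Z) := hZ.continuous_fderiv (by simp)
  have hint : ∀ v w, Integrable (fun y => ⟪fderiv ℝ Z y v, w⟫) (μH[(n : ℝ)] : Measure (En n)) := by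
    intro v w
    refine Continuous.integrable_of_hasCompactSupport (by fun_prop) ?_
    refine hcf.mono (fun x hx h0 => hx ?_)
    show ⟪fderiv ℝ Z x v, w⟫ = 0
    rw [h0]; simp
  unfold divE
  rw [integral_finsetSum _ (fun i _ => hint _ _)]
  refine Finset.sum_eq_zero fun i _ => ?_
  set b := EuclideanSpace.basisFun (Fin n) ℝ i
  have h0 := integral_mul_fderiv_eq_neg_fderiv_mul_of_integrable (𝕜 := ℝ)
    (μ := (μH[(n : ℝ)] : Measure (En n)))
    (f := fun _ => (1 : ℝ)) (g := fun y => ⟪Z y, b⟫) (v := b)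
  have hd : ∀ y, fderiv ℝ (fun y => ⟪Z y, b⟫) y b = ⟪fderiv ℝ Z y b, b⟫ := by
    intro y
    rw [fderiv_inner_apply ℝ ((hZ.differentiable (by simp)) y) (by fun_prop)]
    simp
  simp only [hd, one_mul, fderiv_fun_const, Pi.zero_apply, _root_.zero_apply,
    zero_mul, integral_zero, neg_zero] at h0
  refine h0 (by simp) (hint _ _) ?_ (by fun_prop) ?_
  · refine Continuous.integrable_of_hasCompactSupport (by have := hZ.continuous; fun_prop) ?_
    refine hc.mono (fun x hx h0 => hx ?_)
    show ⟪Z x, b⟫ = 0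
    rw [h0]; simp
  · intro x _
    exact ((hZ.differentiable (by simp)) x).inner ℝ (differentiableAt_const _)

/-- `a / W`. -/
def grQ (g : En n → ℝ) (y : En n) : En n := (grW g y)⁻¹ • gradient g y

lemma grW_pos (g : En n → ℝ) (y : En n) : 0 < grW g y := Real.sqrt_pos.2 (by positivity)

lemma grW_sq (g : En n → ℝ) (y : En n) : grW g y ^ 2 = 1 + ‖gradient g y‖ ^ 2 :=
  Real.sq_sqrt (by positivity)

lemma contDiff_gradient {g : En n → ℝ} (hg : ContDiff ℝ 2 g) : ContDiff ℝ 1 (gradient g) := by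
  have h1 : ContDiff ℝ 1 (fderiv ℝ g) := hg.fderiv_right (by norm_num)
  exact (InnerProductSpace.toDual ℝ (En n)).symm.toContinuousLinearEquiv.contDiff.comp h1

lemma contDiff_grW {g : En n → ℝ} (hg : ContDiff ℝ 2 g) : ContDiff ℝ 1 (grW g) := by
  have := contDiff_gradient hg
  unfold grW
  refine ContDiff.sqrt ?_ (fun y => by positivity)
  exact contDiff_const.add (this.norm_sq ℝ)

lemma contDiff_grQ {g : En n → ℝ} (hg : ContDiff ℝ 2 g) : ContDiff ℝ 1 (grQ g) :=
  ((contDiff_grW hg).inv (fun y => (grW_pos g y).ne')).smul (contDiff_gradient hg)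

lemma grad_symm {g : En n → ℝ} (hg : ContDiff ℝ 2 g) (y u w : En n) :
    ⟪fderiv ℝ (gradient g) y u, w⟫ = ⟪fderiv ℝ (gradient g) y w, u⟫ := by
  have hd : DifferentiableAt ℝ (gradient g) y := (contDiff_gradient hg).differentiable (by simp) y
  have hd' : DifferentiableAt ℝ (fderiv ℝ g) y :=
    (hg.fderiv_right (m := 1) (by norm_num)).differentiable (by simp) y
  have key : ∀ u w, ⟪fderiv ℝ (gradient g) y u, w⟫ = fderiv ℝ (fderiv ℝ g) y u w := by
    intro u w
    have h1 : fderiv ℝ (fun y => ⟪gradient g y, w⟫) y u = ⟪fderiv ℝ (gradient g) y u, w⟫ := by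
      rw [fderiv_inner_apply ℝ hd (by fun_prop)]; simp
    rw [← h1]
    simp only [inner_grad]
    rw [fderiv_clm_apply hd' (by fun_prop)]
    simp
  rw [key, key]
  exact (hg.contDiffAt.isSymmSndFDerivAt (by simp)) u w

lemma fderiv_grW {g : En n → ℝ} (hg : ContDiff ℝ 2 g) (y e : En n) :
    fderiv ℝ (grW g) y e = ⟪fderiv ℝ (gradient g) y (grQ g y), e⟫ := by
  have hd : DifferentiableAt ℝ (gradient g) y := (contDiff_gradient hg).differentiable (by simp) y
  have hW : DifferentiableAt ℝ (grW g) y := (contDiff_grW hg).differentiable (by simp) y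
  have h1 : fderiv ℝ (fun y => grW g y * grW g y) y e
      = fderiv ℝ (fun y => 1 + ⟪gradient g y, gradient g y⟫) y e := by
    congr 2; ext z
    rw [← sq, grW_sq, real_inner_self_eq_norm_sq]
  rw [fderiv_fun_mul hW hW, fderiv_const_add, fderiv_inner_apply ℝ hd hd] at h1
  simp only [_root_.add_apply, _root_.smul_apply, smul_eq_mul] at h1
  rw [real_inner_comm (fderiv ℝ (gradient g) y e)] at h1
  have hp := grW_pos g y
  rw [grad_symm hg, grQ, inner_smul_right]
  rw [eq_inv_mul_iff_mul_eq₀ hp.ne']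
  linarith

/-- The vector field `W w`. -/
def grZ (g : En n → ℝ) (e' : En n) (e0 : ℝ) (y : En n) : En n :=
  grW g y • e' + (e0 - ⟪gradient g y, e'⟫) • grQ g y

lemma contDiff_grZ {g : En n → ℝ} (hg : ContDiff ℝ 2 g) (e' : En n) (e0 : ℝ) :
    ContDiff ℝ 1 (grZ g e' e0) := by
  have h1 := contDiff_grW hg
  have h2 := contDiff_grQ hg
  have h3 := contDiff_gradient hg
  unfold grZ
  exact (h1.smul contDiff_const).add ((contDiff_const.sub (h3.inner ℝ contDiff_const)).smul h2)

lemma divE_grZ {g : En n → ℝ} (hg : ContDiff ℝ 2 g) (e' : En n) (e0 : ℝ) (y : En n) :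
    divE (grZ g e' e0) y = (e0 - ⟪gradient g y, e'⟫) * divE (grQ g) y := by
  have hd : DifferentiableAt ℝ (gradient g) y := (contDiff_gradient hg).differentiable (by simp) y
  have hW : DifferentiableAt ℝ (grW g) y := (contDiff_grW hg).differentiable (by simp) y
  have hQ : DifferentiableAt ℝ (grQ g) y := (contDiff_grQ hg).differentiable (by simp) y
  have hi : DifferentiableAt ℝ (fun y => e0 - ⟪gradient g y, e'⟫) y := by
    exact (differentiableAt_const _).sub (hd.inner ℝ (differentiableAt_const _))
  have h1 : divE (grZ g e' e0) y = divE (fun y => grW g y • e') y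
      + divE (fun y => (e0 - ⟪gradient g y, e'⟫) • grQ g y) y :=
    divE_add (hW.smul (differentiableAt_const _)) (hi.smul hQ)
  rw [h1, divE_smul hi hQ, divE_smul hW (differentiableAt_const e'), divE_const, fderiv_grW hg,
    fderiv_const_sub, _root_.neg_apply,
    fderiv_inner_apply ℝ hd (differentiableAt_const _)]
  simp

lemma fv_flat {g : En n → ℝ} (hg : ContDiff ℝ 2 g) {v : En n → ℝ} (hv : ContDiff ℝ 1 v)
    (hc : HasCompactSupport v) (e' : En n) (e0 : ℝ) :
    ∫ y, (fderiv ℝ v y (grZ g e' e0 y) + v y * ((e0 - ⟪gradient g y, e'⟫) * divE (grQ g) y))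
      ∂(μH[(n : ℝ)] : Measure (En n)) = 0 := by
  have hZ := contDiff_grZ hg e' e0
  rw [← integral_divE (hv.smul hZ) (hc.smul_right)]
  congr 1; ext y
  have := divE_smul (hv.differentiable (by simp) y) (hZ.differentiable (by simp) y)
  rw [← divE_grZ hg, add_comm, ← this]
  rfl

/-- Orthogonal projection onto the complement of a unit vector. -/
def tP (N : Eu n) : Eu n →L[ℝ] Eu n :=
  ContinuousLinearMap.id ℝ _ - (innerSL ℝ N).smulRight N

lemma tP_apply (N e : Eu n) : tP N e = e - ⟪N, e⟫ • N := by simp [tP]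

lemma tdiv_eq_sum {N Z : Eu n → Eu n} {x : Eu n} (hZ : DifferentiableAt ℝ Z x) :
    tdiv N Z x = ∑ i, (fderiv ℝ Z x (tP (N x) (EuclideanSpace.single i 1))) i := by
  unfold tdiv tderiv
  refine Finset.sum_congr rfl fun i _ => ?_
  have h1 : ∀ v, fderiv ℝ (fun y => Z y i) x v = (fderiv ℝ Z x v) i := by
    intro v
    have h : HasFDerivAt (fun y => Z y i) ((EuclideanSpace.proj i).comp (fderiv ℝ Z x)) x :=
      (EuclideanSpace.proj (𝕜 := ℝ) i).hasFDerivAt.comp x hZ.hasFDerivAt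
    rw [h.fderiv]; rfl
  have h2 : N x = ∑ j, N x j • EuclideanSpace.single j (1 : ℝ) := by
    ext k; simp [Finset.sum_apply, Pi.single_apply]
  have h3 : fderiv ℝ Z x (N x) = ∑ j, N x j • fderiv ℝ Z x (EuclideanSpace.single j (1 : ℝ)) := by
    conv_lhs => rw [h2]
    rw [map_sum]; simp
  have h4 : ⟪N x, EuclideanSpace.single i (1 : ℝ)⟫ = N x i := by
    simp [EuclideanSpace.inner_single_right]
  rw [tP_apply, map_sub, map_smul, h3, h4]
  simp only [h1, PiLp.sub_apply, PiLp.smul_apply, smul_eq_mul]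
  congr 2
  rw [WithLp.ofLp_sum, Finset.sum_apply]
  refine Finset.sum_congr rfl fun j _ => ?_
  simp [mul_comm]

lemma tdiv_eq_trace {N Z : Eu n → Eu n} {x : Eu n} (hZ : DifferentiableAt ℝ Z x) :
    tdiv N Z x = LinearMap.trace ℝ (Eu n) ((fderiv ℝ Z x).toLinearMap ∘ₗ (tP (N x)).toLinearMap) := by
  rw [tdiv_eq_sum hZ, LinearMap.trace_eq_sum_inner _ (EuclideanSpace.basisFun (Fin (n + 1)) ℝ)]
  refine Finset.sum_congr rfl fun i _ => ?_
  simp [EuclideanSpace.inner_single_left]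

lemma divE_eq_trace (Z : En n → En n) (y : En n) :
    divE Z y = LinearMap.trace ℝ (En n) (fderiv ℝ Z y).toLinearMap := by
  rw [LinearMap.trace_eq_sum_inner _ (EuclideanSpace.basisFun (Fin n) ℝ), divE]
  refine Finset.sum_congr rfl fun i _ => ?_
  rw [real_inner_comm]; rfl

def adjL (L : En n →ₗᵢ[ℝ] Eu n) : Eu n →L[ℝ] En n :=
  ContinuousLinearMap.adjoint L.toContinuousLinearMap

lemma adjL_inner (L : En n →ₗᵢ[ℝ] Eu n) (x : Eu n) (w : En n) : ⟪adjL L x, w⟫ = ⟪x, L w⟫ := by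
  simp [adjL, ContinuousLinearMap.adjoint_inner_left]

lemma adjL_map (L : En n →ₗᵢ[ℝ] Eu n) (w : En n) : adjL L (L w) = w := by
  refine ext_inner_right ℝ fun v => ?_
  rw [adjL_inner, L.inner_map_map]

lemma adjL_nu {L : En n →ₗᵢ[ℝ] Eu n} {ν0 : Eu n} (h : IsFrame L ν0) : adjL L ν0 = 0 := by
  refine ext_inner_right ℝ fun v => ?_
  rw [adjL_inner, real_inner_comm, h.orth]; simp

lemma frame_decomp {L : En n →ₗᵢ[ℝ] Eu n} {ν0 : Eu n} (h : IsFrame L ν0) (x : Eu n) :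
    x = L (adjL L x) + ⟪x, ν0⟫ • ν0 := by
  obtain ⟨w, hw⟩ := h.surj (x - ⟪x, ν0⟫ • ν0) (by
    rw [inner_sub_left, inner_smul_left, real_inner_self_eq_norm_sq, h.unit]; simp)
  have hx : x = L w + ⟪x, ν0⟫ • ν0 := by rw [hw]; abel
  have : adjL L x = w := by
    conv_lhs => rw [hx]
    rw [map_add, map_smul, adjL_map, adjL_nu h]; simp
  rwa [this]

/-- The unit normal of the graph. -/
def grN (L : En n →ₗᵢ[ℝ] Eu n) (ν0 : Eu n) (g : En n → ℝ) (y : En n) : Eu n :=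
  (grW g y)⁻¹ • ν0 - L (grQ g y)

lemma hasFDerivAt_gr (L : En n →ₗᵢ[ℝ] Eu n) (ν0 ξ : Eu n) {g : En n → ℝ} {y : En n}
    (hg : DifferentiableAt ℝ g y) :
    HasFDerivAt (gr L ν0 ξ g) (grA L ν0 (gradient g y)) y := by
  have h1 : HasFDerivAt (fun y => ξ + L y + g y • ν0)
      (L.toContinuousLinearMap + (fderiv ℝ g y).smulRight ν0) y := by
    exact (L.toContinuousLinearMap.hasFDerivAt.const_add ξ).add (hg.hasFDerivAt.smul_const ν0)
  convert! h1 using 1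
  ext1 w
  simp [grA_apply, inner_grad]

lemma grN_inner {L : En n →ₗᵢ[ℝ] Eu n} {ν0 : Eu n} (h : IsFrame L ν0) (g : En n → ℝ) (y e' : En n)
    (e0 : ℝ) : grW g y * ⟪grN L ν0 g y, L e' + e0 • ν0⟫ = e0 - ⟪gradient g y, e'⟫ := by
  have hp := grW_pos g y
  have h2 : ⟪ν0, L e'⟫ = 0 := by rw [real_inner_comm]; exact h.orth _
  simp only [grN, grQ, inner_sub_left, inner_add_right, inner_smul_left, inner_smul_right, h2, h.orth,
    L.inner_map_map, real_inner_self_eq_norm_sq, h.unit]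
  simp
  field_simp
  try ring

lemma grN_norm {L : En n →ₗᵢ[ℝ] Eu n} {ν0 : Eu n} (h : IsFrame L ν0) (g : En n → ℝ) (y : En n) :
    ‖grN L ν0 g y‖ = 1 := by
  have h1 : grN L ν0 g y = L (-grQ g y) + (grW g y)⁻¹ • ν0 := by
    rw [grN, map_neg]; abel
  have h2 := frame_norm h (-grQ g y) (grW g y)⁻¹
  rw [← h1, norm_neg, grQ, norm_smul] at h2
  have hp := grW_pos g y
  have h3 : ‖grN L ν0 g y‖ ^ 2 = 1 := by
    rw [h2, Real.norm_eq_abs, abs_of_pos (inv_pos.2 hp), mul_pow, inv_pow, grW_sq]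
    field_simp
    ring
  nlinarith [norm_nonneg (grN L ν0 g y)]

lemma tangent_eq {L : En n →ₗᵢ[ℝ] Eu n} {ν0 : Eu n} (h : IsFrame L ν0) (g : En n → ℝ) (y : En n)
    (x : Eu n) (hx : ⟪grN L ν0 g y, x⟫ = 0) : x = grA L ν0 (gradient g y) (adjL L x) := by
  have h1 := frame_decomp h x
  have h2 := grN_inner h g y (adjL L x) ⟪x, ν0⟫
  rw [← h1, hx, mul_zero] at h2
  rw [grA_apply]
  have : ⟪gradient g y, adjL L x⟫ = ⟪x, ν0⟫ := by linarith
  rw [this]; exact h1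

lemma tP_orth {N : Eu n} (hN : ‖N‖ = 1) (x : Eu n) : ⟪N, tP N x⟫ = 0 := by
  rw [tP_apply, inner_sub_right, inner_smul_right, real_inner_self_eq_norm_sq, hN]; simp

lemma chart_deriv {L : En n →ₗᵢ[ℝ] Eu n} {ν0 : Eu n} (h : IsFrame L ν0) (ξ : Eu n) {g : En n → ℝ}
    {y : En n} (hg : DifferentiableAt ℝ g y) {u : Eu n → ℝ}
    (hu : DifferentiableAt ℝ u (gr L ν0 ξ g y)) (e' : En n) (e0 : ℝ) :
    grW g y * fderiv ℝ u (gr L ν0 ξ g y) (tP (grN L ν0 g y) (L e' + e0 • ν0)) =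
      fderiv ℝ (fun z => u (gr L ν0 ξ g z)) y (grZ g e' e0 y) := by
  have hc : HasFDerivAt (fun z => u (gr L ν0 ξ g z)) _ y :=
    hu.hasFDerivAt.comp y (hasFDerivAt_gr L ν0 ξ hg)
  rw [hc.fderiv]
  have h1 := tangent_eq h g y _ (tP_orth (grN_norm h g y) (L e' + e0 • ν0))
  set e := L e' + e0 • ν0
  have h2 : grW g y • adjL L (tP (grN L ν0 g y) e) = grZ g e' e0 y := by
    have h4 := grN_inner h g y e' e0
    rw [tP_apply, grZ, ← h4]
    simp only [e, grN, map_sub, map_smul, map_add, adjL_map, adjL_nu h]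
    simp [smul_smul]
  rw [← h2]
  simp only [ContinuousLinearMap.comp_apply, map_smul, smul_eq_mul]
  rw [← h1]

lemma meanCurv_chart {L : En n →ₗᵢ[ℝ] Eu n} {ν0 : Eu n} (h : IsFrame L ν0) (ξ : Eu n) {g : En n → ℝ}
    {y : En n} (hg : ContDiff ℝ 2 g) {N : Eu n → Eu n}
    (hN : DifferentiableAt ℝ N (gr L ν0 ξ g y))
    (hNg : ∀ᶠ z in nhds y, N (gr L ν0 ξ g z) = grN L ν0 g z) :
    tdiv N N (gr L ν0 ξ g y) = - divE (grQ g) y := by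
  have hgd : DifferentiableAt ℝ g y := hg.differentiable (by simp) y
  have hQ : DifferentiableAt ℝ (grQ g) y := (contDiff_grQ hg).differentiable (by simp) y
  set x := gr L ν0 ξ g y with hx
  set A := grA L ν0 (gradient g y) with hA
  set T := fderiv ℝ N x with hT
  have hNy : N x = grN L ν0 g y := hNg.self_of_nhds
  have hc : HasFDerivAt (fun z => N (gr L ν0 ξ g z)) (T.comp A) y :=
    hN.hasFDerivAt.comp y (hasFDerivAt_gr L ν0 ξ hgd)
  -- orthogonality
  have horth : ∀ w, ⟪N x, T (A w)⟫ = 0 := by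
    intro w
    have h1 : (fun z => ⟪N (gr L ν0 ξ g z), N (gr L ν0 ξ g z)⟫) =ᶠ[nhds y] fun _ => (1 : ℝ) := by
      filter_upwards [hNg] with z hz
      rw [hz, real_inner_self_eq_norm_sq, grN_norm h]; simp
    have h2 := congrArg (fun T : En n →L[ℝ] ℝ => T w) (h1.fderiv_eq (𝕜 := ℝ))
    rw [fderiv_inner_apply ℝ hc.differentiableAt hc.differentiableAt, hc.fderiv] at h2
    rw [real_inner_comm (N (gr L ν0 ξ g y))] at h2
    simp only [ContinuousLinearMap.comp_apply, fderiv_fun_const, Pi.zero_apply,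
      _root_.zero_apply, ← hx] at h2
    rw [real_inner_comm] at h2
    rw [real_inner_comm]
    linarith
  have hadj : HasFDerivAt (fun z => - grQ g z) ((adjL L).comp (T.comp A)) y := by
    have h1 := (adjL L).hasFDerivAt.comp y hc
    refine h1.congr_of_eventuallyEq ?_
    filter_upwards [hNg] with z hz
    simp only [Function.comp, hz, grN, map_sub, map_smul, adjL_map, adjL_nu h]
    simp
  have hadj2 : (adjL L).comp (T.comp A) = - fderiv ℝ (grQ g) y := by
    rw [← hadj.fderiv, fderiv_fun_neg]
  rw [tdiv_eq_trace hN, divE_eq_trace]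
  have e1 : T.toLinearMap ∘ₗ (tP (N x)).toLinearMap =
      (T.toLinearMap ∘ₗ A.toLinearMap) ∘ₗ ((adjL L).toLinearMap ∘ₗ (tP (N x)).toLinearMap) := by
    refine LinearMap.ext fun v => ?_
    have := tangent_eq h g y _ (by rw [← hNy]; exact tP_orth (by rw [hNy]; exact grN_norm h g y) v)
    simp only [LinearMap.comp_apply, ContinuousLinearMap.coe_coe]
    rw [← this]
  rw [e1, LinearMap.trace_comp_comm']
  have e2 : ((adjL L).toLinearMap ∘ₗ (tP (N x)).toLinearMap) ∘ₗ (T.toLinearMap ∘ₗ A.toLinearMap) =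
      - (fderiv ℝ (grQ g) y).toLinearMap := by
    refine LinearMap.ext fun v => ?_
    have h3 := congrArg (fun S : En n →L[ℝ] En n => S v) hadj2
    simp only [ContinuousLinearMap.comp_apply, _root_.neg_apply] at h3
    simp only [LinearMap.comp_apply, ContinuousLinearMap.coe_coe, LinearMap.neg_apply]
    rw [← h3, tP_apply, horth]; simp
  rw [e2, map_neg]

structure IsChart (M : Hypersurface n) (ξ : Eu n) (L : En n →ₗᵢ[ℝ] Eu n) (g : En n → ℝ)
    (V : Set (Eu n)) : Prop where
  frame : IsFrame L (M.nu ξ)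
  cd : ContDiff ℝ 2 g
  lip : ∃ C, LipschitzWith C g
  zero : g 0 = 0
  opn : IsOpen V
  mem : ξ ∈ V
  iff : ∀ x ∈ V, x ∈ M.carrier ↔ x ∈ Set.range (gr L (M.nu ξ) ξ g)
  nu : ∀ y, gr L (M.nu ξ) ξ g y ∈ V → M.nu (gr L (M.nu ξ) ξ g y) = grN L (M.nu ξ) g y

lemma normal_of_tangent {L : En n →ₗᵢ[ℝ] Eu n} {ν0 : Eu n} (h : IsFrame L ν0) {N : Eu n}
    (hN : ‖N‖ = 1) (hpos : 0 < ⟪N, ν0⟫) (g : En n → ℝ) (y : En n)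
    (ht : ∀ w, ⟪N, grA L ν0 (gradient g y) w⟫ = 0) : N = grN L ν0 g y := by
  have h1 := frame_decomp h N
  have hp : adjL L N = -(⟪N, ν0⟫ • gradient g y) := by
    refine ext_inner_right ℝ fun w => ?_
    have := ht w
    rw [grA_apply, inner_add_right, inner_smul_right, ← adjL_inner] at this
    rw [inner_neg_left, real_inner_smul_left]; linarith
  have h2 := frame_norm h (adjL L N) ⟪N, ν0⟫
  rw [← h1, hN, hp, norm_neg, norm_smul, mul_pow, Real.norm_eq_abs, sq_abs] at h2
  have hW := grW_sq g y
  have hWp := grW_pos g y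
  have hs : ⟪N, ν0⟫ = (grW g y)⁻¹ := by
    have : (⟪N, ν0⟫ * grW g y) ^ 2 = 1 := by rw [mul_pow, hW]; linarith
    have h3 : ⟪N, ν0⟫ * grW g y = 1 := by
      have : 0 < ⟪N, ν0⟫ * grW g y := by positivity
      nlinarith
    field_simp; linarith
  rw [h1, hp, hs, grN, grQ, map_neg]; abel

lemma exists_chart (M : Hypersurface n) {ξ : Eu n} (hξ : ξ ∈ M.carrier) :
    ∃ L g V, IsChart M ξ L g V := by
  obtain ⟨U, hU, hξU, f, hf, hMU, hgr, hnu⟩ := M.locally_level_set ξ hξ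
  set ν0 := M.nu ξ with hν0
  obtain ⟨L, hL⟩ := exists_frame ν0 (M.unit_nu ξ hξ)
  have hf2 : ContDiff ℝ 2 f := hf.of_le (WithTop.coe_le_coe.2 le_top)
  have hfd : Differentiable ℝ f := hf.differentiable (by simp)
  let Φ : En n × ℝ → Eu n := fun v => ξ + L v.1 + v.2 • ν0
  let Φ' : En n × ℝ →L[ℝ] Eu n := L.toContinuousLinearMap.comp (.fst ℝ _ _) +
    (ContinuousLinearMap.snd ℝ (En n) ℝ).smulRight ν0
  have hΦ : ∀ v, HasFDerivAt Φ Φ' v := by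
    intro v
    have : HasFDerivAt (fun v => ξ + Φ' v) Φ' v := Φ'.hasFDerivAt.const_add ξ
    convert! this using 1
    ext1 v; simp only [Φ, Φ', add_assoc]; rfl
  have hΦc : ContDiff ℝ 2 Φ := by
    have : ContDiff ℝ 2 (fun v => ξ + Φ' v) := contDiff_const.add Φ'.contDiff
    convert! this using 1
    ext1 v; simp only [Φ, Φ', add_assoc]; rfl
  let F : En n × ℝ → ℝ := fun v => f (Φ v)
  have hF : ContDiffAt ℝ 2 F 0 := (hf2.comp hΦc).contDiffAt
  have hΦ0 : Φ 0 = ξ := by simp [Φ]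
  have hFd : fderiv ℝ F 0 = (fderiv ℝ f ξ).comp Φ' := by
    have : HasFDerivAt F _ 0 := (hfd (Φ 0)).hasFDerivAt.comp 0 (hΦ 0)
    rw [this.fderiv, hΦ0]
  have hc : fderiv ℝ f ξ ν0 ≠ 0 := by
    rw [← inner_grad, hν0, hnu ξ ⟨hξ, hξU⟩, inner_smul_right, real_inner_self_eq_norm_sq]
    have := norm_ne_zero_iff.2 (hgr ξ hξU)
    positivity
  have hinv : (fderiv ℝ F 0 ∘L .inr ℝ (En n) ℝ).IsInvertible := by
    refine ⟨ContinuousLinearEquiv.unitsEquivAut ℝ (Units.mk0 _ hc), ?_⟩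
    rw [hFd]
    ext
    simp [Φ']
  set ψ := hF.implicitFunction two_ne_zero hinv with hψ
  have hψc : ContDiffAt ℝ 2 ψ 0 := hF.contDiffAt_implicitFunction two_ne_zero hinv
  have hψ0 : ψ 0 = 0 := hF.implicitFunction_apply_self two_ne_zero hinv
  have hiff := hF.eventually_apply_eq_iff_implicitFunction two_ne_zero hinv
  obtain ⟨δ, hδ, hψδ⟩ := Metric.eventually_nhds_iff_ball.1 (hψc.eventually (by simp))
  let χ : ContDiffBump (0 : En n) := ⟨δ/3, δ/2, by positivity, by linarith⟩
  let g : En n → ℝ := fun y => χ y * ψ y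
  have hχ1 : ∀ y ∈ Metric.ball (0 : En n) (δ/3), g y = ψ y := by
    intro y hy
    simp only [g]; rw [χ.one_of_mem_closedBall (Metric.ball_subset_closedBall hy), one_mul]
  have hgc : ContDiff ℝ 2 g := by
    rw [contDiff_iff_contDiffAt]
    intro y
    by_cases hy : y ∈ Metric.ball (0 : En n) δ
    · exact χ.contDiff.contDiffAt.mul (hψδ y hy)
    · have : y ∉ tsupport χ := by
        rw [χ.tsupport_eq]
        simp [χ] at hy ⊢; linarith
      have h0 : χ =ᶠ[nhds y] 0 := notMem_tsupport_iff_eventuallyEq.1 this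
      have : g =ᶠ[nhds y] fun _ => 0 := by
        filter_upwards [h0] with z hz
        simp [g, hz]
      exact contDiffAt_const.congr_of_eventuallyEq this
  have hgs : HasCompactSupport g := χ.hasCompactSupport.mul_right
  have hLip : ∃ C, LipschitzWith C g := hgc.lipschitzWith_of_hasCompactSupport hgs (by simp)
  let q : Eu n → En n × ℝ := fun x => (adjL L (x - ξ), ⟪x - ξ, ν0⟫)
  have hq : Continuous q := by fun_prop
  have hqξ : q ξ = 0 := by simp [q]
  have hΦq : ∀ x, Φ (q x) = x := by
    intro x
    have := frame_decomp hL (x - ξ)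
    simp only [Φ, q]; rw [add_assoc, ← this]; abel
  have hqgr : ∀ y, q (gr L ν0 ξ g y) = (y, g y) := by
    intro y
    have : gr L ν0 ξ g y - ξ = L y + g y • ν0 := by rw [gr]; abel
    simp only [q, this, map_add, map_smul, adjL_map, adjL_nu hL, inner_add_left, hL.orth, inner_smul_left,
      real_inner_self_eq_norm_sq, hL.unit]
    simp
  have hev : ∀ᶠ x in nhds ξ, x ∈ U ∧ (F (q x) = F 0 ↔ ψ (q x).1 = (q x).2) ∧
      (q x).1 ∈ Metric.ball (0 : En n) (δ/3) ∧ 0 < ⟪M.nu x, ν0⟫ := by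
    have hq0 : Filter.Tendsto q (nhds ξ) (nhds 0) := by rw [← hqξ]; exact hq.continuousAt
    refine (hU.eventually_mem hξU).and ((hq0.eventually hiff).and (Filter.Eventually.and ?_ ?_))
    · have : Filter.Tendsto (fun x => (q x).1) (nhds ξ) (nhds 0) :=
        (continuous_fst.tendsto (0 : En n × ℝ)).comp hq0
      exact this.eventually (Metric.ball_mem_nhds _ (by positivity))
    · have : Continuous fun x => ⟪M.nu x, ν0⟫ := M.smooth_nu.continuous.inner continuous_const
      refine this.continuousAt.eventually (lt_mem_nhds ?_)
      change 0 < ⟪ν0, ν0⟫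
      rw [real_inner_self_eq_norm_sq, hL.unit]; norm_num
  obtain ⟨V, hVs, hVo, hξV⟩ := eventually_nhds_iff.1 hev
  have hiffV : ∀ x ∈ V, x ∈ M.carrier ↔ x ∈ Set.range (gr L ν0 ξ g) := by
    intro x hx
    obtain ⟨h1, h2, h3, h4⟩ := hVs x hx
    have e1 : x ∈ M.carrier ↔ f x = 0 := by
      have : x ∈ M.carrier ∩ U ↔ x ∈ {y ∈ U | f y = 0} := by rw [hMU]
      simpa [h1] using this
    have e0 : F 0 = 0 := by
      have : ξ ∈ M.carrier ∩ U := ⟨hξ, hξU⟩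
      rw [hMU] at this
      simp only [F, hΦ0]; exact this.2
    simp only [e0] at h2
    simp only [F, hΦq] at h2
    rw [e1, h2, ← hχ1 _ h3]
    constructor
    · intro h
      refine ⟨(q x).1, ?_⟩
      rw [gr, h]; exact hΦq x
    · rintro ⟨y, rfl⟩
      rw [hqgr]
  refine ⟨L, g, V, ⟨hL, hgc, hLip, ?_, hVo, hξV, hiffV, ?_⟩⟩
  · rw [hχ1 0 (by simp; positivity), hψ0]
  · intro y hy
    obtain ⟨h1, h2, h3, h4⟩ := hVs _ hy
    have hM := (hiffV _ hy).2 ⟨y, rfl⟩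
    have hgd : DifferentiableAt ℝ g y := hgc.differentiable (by simp) y
    refine normal_of_tangent hL (M.unit_nu _ hM) h4 g y fun w => ?_
    have hcc := hasFDerivAt_gr L ν0 ξ hgd
    have h5 : (fun z => f (gr L ν0 ξ g z)) =ᶠ[nhds y] fun _ => (0 : ℝ) := by
      filter_upwards [hcc.continuousAt.eventually (hVo.mem_nhds hy)] with z hz
      have hz' : gr L ν0 ξ g z ∈ M.carrier ∩ U := ⟨(hiffV _ hz).2 ⟨z, rfl⟩, (hVs _ hz).1⟩
      rw [hMU] at hz'
      exact hz'.2
    have h6 : HasFDerivAt (fun z => f (gr L ν0 ξ g z)) _ y := (hfd _).hasFDerivAt.comp y hcc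
    have h7 := h6.unique ((hasFDerivAt_const (0 : ℝ) y).congr_of_eventuallyEq h5)
    have h8 := congrArg (fun T : En n →L[ℝ] ℝ => T w) h7
    simp at h8
    rw [hnu _ ⟨hM, h1⟩, inner_smul_left, inner_grad, h8]
    simp

lemma IsChart.meas {M : Hypersurface n} {ξ : Eu n} {L : En n →ₗᵢ[ℝ] Eu n} {g : En n → ℝ}
    {V : Set (Eu n)} (hc : IsChart M ξ L g V) :
    (μH[(n : ℝ)] : Measure (Eu n)).restrict (Set.range (gr L (M.nu ξ) ξ g)) =
      (((μH[(n : ℝ)] : Measure (En n)).withDensity (fun y => ENNReal.ofReal (grW g y))).map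
        (gr L (M.nu ξ) ξ g)) := by
  obtain ⟨C, hC⟩ := hc.lip
  rw [← area_formula hc.frame ξ (hc.cd.of_le (by norm_num)) hC,
    (gr_embedding hc.frame ξ hC).measurableEmbedding.map_comap]

lemma IsChart.inter {M : Hypersurface n} {ξ : Eu n} {L : En n →ₗᵢ[ℝ] Eu n} {g : En n → ℝ}
    {V : Set (Eu n)} (hc : IsChart M ξ L g V) :
    M.carrier ∩ V = Set.range (gr L (M.nu ξ) ξ g) ∩ V := by
  ext x
  constructor
  · rintro ⟨h1, h2⟩; exact ⟨(hc.iff x h2).1 h1, h2⟩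
  · rintro ⟨h1, h2⟩; exact ⟨(hc.iff x h2).2 h1, h2⟩

lemma IsChart.integral {M : Hypersurface n} {ξ : Eu n} {L : En n →ₗᵢ[ℝ] Eu n} {g : En n → ℝ}
    {V : Set (Eu n)} (hc : IsChart M ξ L g V) (F : Eu n → ℝ) (hF : ∀ x ∉ V, F x = 0) :
    ∫ x, F x ∂surfMeasure M = ∫ y, grW g y * F (gr L (M.nu ξ) ξ g y) ∂(μH[(n : ℝ)] : Measure (En n)) := by
  obtain ⟨C, hC⟩ := hc.lip
  have hFi : V.indicator F = F := by
    ext x; by_cases hx : x ∈ V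
    · simp [hx]
    · simp [hx, hF x hx]
  rw [surfMeasure, ← hFi, setIntegral_indicator hc.opn.measurableSet, hc.inter,
    ← setIntegral_indicator hc.opn.measurableSet, hFi, hc.meas,
    (gr_embedding hc.frame ξ hC).measurableEmbedding.integral_map,
    integral_withDensity_eq_integral_toReal_smul]
  · refine integral_congr_ae (Filter.Eventually.of_forall fun y => ?_)
    simp only [smul_eq_mul, ENNReal.toReal_ofReal (grW_pos g y).le]
  · exact (contDiff_grW hc.cd).continuous.measurable.ennreal_ofReal
  · exact Filter.Eventually.of_forall fun y => ENNReal.ofReal_lt_top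

lemma IsChart.finite {M : Hypersurface n} {ξ : Eu n} {L : En n →ₗᵢ[ℝ] Eu n} {g : En n → ℝ}
    {V : Set (Eu n)} (hc : IsChart M ξ L g V) :
    surfMeasure M (V ∩ Metric.closedBall ξ 1) < ⊤ := by
  obtain ⟨C, hC⟩ := hc.lip
  have hemb := gr_embedding hc.frame ξ hC
  have hm : MeasurableSet (V ∩ Metric.closedBall ξ 1) :=
    hc.opn.measurableSet.inter measurableSet_closedBall
  have h1 : surfMeasure M (V ∩ Metric.closedBall ξ 1) ≤
      (μH[(n : ℝ)] : Measure (Eu n)).restrict (Set.range (gr L (M.nu ξ) ξ g)) (Metric.closedBall ξ 1) := by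
    rw [surfMeasure, Measure.restrict_apply hm, Measure.restrict_apply measurableSet_closedBall]
    refine measure_mono ?_
    rintro x ⟨⟨h1, h2⟩, h3⟩
    exact ⟨h2, (hc.iff x h1).1 h3⟩
  refine h1.trans_lt ?_
  rw [hc.meas, hemb.measurableEmbedding.map_apply]
  have := IsLocallyFiniteMeasure.withDensity_ofReal (μ := (μH[(n : ℝ)] : Measure (En n)))
    (contDiff_grW hc.cd).continuous
  exact (hemb.isCompact_preimage (isCompact_closedBall ξ 1)).measure_lt_top

lemma locClosed (M : Hypersurface n) : IsLocallyClosed M.carrier := by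
  refine ((isLocallyClosed_tfae M.carrier).out 0 3).2 fun ξ hξ => ?_
  obtain ⟨L, g, V, hc⟩ := exists_chart M hξ
  obtain ⟨C, hC⟩ := hc.lip
  refine ⟨V, hc.mem, hc.opn, ?_⟩
  rintro x ⟨hxV, hx⟩
  refine (hc.iff x hxV).2 ?_
  rw [← (gr_embedding hc.frame ξ hC).isClosed_range.closure_eq]
  have : x ∈ closure (V ∩ M.carrier) := hc.opn.inter_closure ⟨hxV, hx⟩
  rw [Set.inter_comm, hc.inter] at this
  exact closure_mono Set.inter_subset_left this

lemma measM (M : Hypersurface n) : MeasurableSet M.carrier := by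
  obtain ⟨U, Z, hU, hZ, h⟩ := locClosed M
  rw [h]; exact hU.measurableSet.inter hZ.measurableSet

lemma finite_compact (M : Hypersurface n) {K : Set (Eu n)} (hK : IsCompact K) (hKM : K ⊆ M.carrier) :
    surfMeasure M K < ⊤ := by
  refine hK.measure_lt_top_of_nhdsWithin fun x hx => ?_
  obtain ⟨L, g, V, hc⟩ := exists_chart M (hKM hx)
  exact ⟨V ∩ Metric.closedBall x 1, mem_nhdsWithin_of_mem_nhds
    (Filter.inter_mem (hc.opn.mem_nhds hc.mem) (Metric.closedBall_mem_nhds x one_pos)), hc.finite⟩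

lemma integrable_cont (M : Hypersurface n) {K : Set (Eu n)} (hK : IsCompact K) (hKM : K ⊆ M.carrier)
    {F : Eu n → ℝ} (hF : ContinuousOn F K) (h0 : ∀ x ∈ M.carrier, x ∉ K → F x = 0) :
    Integrable F (surfMeasure M) := by
  have h1 : IntegrableOn F K (μH[(n : ℝ)] : Measure (Eu n)) := by
    obtain ⟨B, hB⟩ := hK.exists_bound_of_continuousOn hF
    have hfin : (μH[(n : ℝ)] : Measure (Eu n)) K < ⊤ := by
      have := finite_compact M hK hKM
      rwa [surfMeasure, Measure.restrict_apply hK.measurableSet, Set.inter_eq_left.2 hKM] at this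
    have : IsFiniteMeasure ((μH[(n : ℝ)] : Measure (Eu n)).restrict K) := ⟨by simpa using hfin⟩
    refine Integrable.of_bound (hF.aestronglyMeasurable hK.measurableSet) B ?_
    exact ae_restrict_of_forall_mem hK.measurableSet hB
  exact h1.of_forall_sdiff_eq_zero (measM M) (fun x hx => h0 x hx.1 hx.2)

lemma tgrad_inner (N : Eu n → Eu n) (u : Eu n → ℝ) (x e : Eu n) :
    ⟪tgrad N u x, e⟫ = fderiv ℝ u x (tP (N x) e) := by
  rw [tgrad, tP_apply, inner_sub_left, real_inner_smul_left, inner_grad, inner_grad, map_sub, map_smul,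
    smul_eq_mul, mul_comm]

/-- First variation integrand. -/
def FVi (M : Hypersurface n) (u : Eu n → ℝ) (e x : Eu n) : ℝ :=
  ⟪tgrad M.nu u x, e⟫ - meanCurv M x * ⟪M.nu x, e⟫ * u x

lemma tgrad_zero_of {N : Eu n → Eu n} {u : Eu n → ℝ} {x : Eu n} (h : x ∉ tsupport u) :
    tgrad N u x = 0 := by
  have : fderiv ℝ u x = 0 := by
    by_contra hne
    exact h (support_fderiv_subset ℝ hne)
  simp [tgrad, gradient, this]

lemma FVi_zero {M : Hypersurface n} {u : Eu n → ℝ} {e x : Eu n} (h : x ∉ tsupport u) :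
    FVi M u e x = 0 := by
  rw [FVi, tgrad_zero_of h, image_eq_zero_of_notMem_tsupport h]; simp

lemma cont_tgrad (M : Hypersurface n) {u : Eu n → ℝ} (hu : ContDiff ℝ 1 u) :
    Continuous (tgrad M.nu u) := by
  have h1 : Continuous (gradient u) :=
    (InnerProductSpace.toDual ℝ (Eu n)).symm.continuous.comp (hu.continuous_fderiv (by simp))
  have h2 := M.smooth_nu.continuous
  unfold tgrad
  fun_prop

lemma nu_diff (M : Hypersurface n) : Differentiable ℝ M.nu := M.smooth_nu.differentiable (by simp)

lemma cont_H (M : Hypersurface n) : Continuous (meanCurv M) := by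
  have h2 := M.smooth_nu.continuous
  have h3 : Continuous (fderiv ℝ M.nu) := M.smooth_nu.continuous_fderiv (by simp)
  have : meanCurv M = fun x => ∑ i, (fderiv ℝ M.nu x (EuclideanSpace.single i 1 -
      ⟪M.nu x, EuclideanSpace.single i 1⟫ • M.nu x)) i := by
    ext x; rw [meanCurv, tdiv_eq_sum (nu_diff M x)]; simp only [tP_apply]
  rw [this]
  refine continuous_finsetSum _ fun i _ => ?_
  have h4 : Continuous fun x => fderiv ℝ M.nu x (EuclideanSpace.single i 1 -
      ⟪M.nu x, EuclideanSpace.single i 1⟫ • M.nu x) := by fun_prop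
  exact (EuclideanSpace.proj (𝕜 := ℝ) i).continuous.comp h4

lemma cont_FVi (M : Hypersurface n) {u : Eu n → ℝ} (hu : ContDiff ℝ 1 u) (e : Eu n) :
    Continuous (FVi M u e) := by
  have h1 := cont_tgrad M hu
  have h2 := cont_H M
  have h3 := M.smooth_nu.continuous
  have h4 := hu.continuous
  unfold FVi
  fun_prop

lemma contDiff_gr (L : En n →ₗᵢ[ℝ] Eu n) (ν0 ξ : Eu n) {g : En n → ℝ} (hg : ContDiff ℝ 2 g) :
    ContDiff ℝ 2 (gr L ν0 ξ g) := by
  have : ContDiff ℝ 2 (fun y => ξ + L.toContinuousLinearMap y + g y • ν0) := by fun_prop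
  exact this

lemma fv_local {M : Hypersurface n} {ξ : Eu n} {L : En n →ₗᵢ[ℝ] Eu n} {g : En n → ℝ}
    {V : Set (Eu n)} (hc : IsChart M ξ L g V) {u : Eu n → ℝ} (hu : ContDiff ℝ 1 u)
    (hs : HasCompactSupport u) (hV : tsupport u ⊆ V) (e : Eu n) :
    ∫ x, FVi M u e x ∂surfMeasure M = 0 := by
  obtain ⟨C, hC⟩ := hc.lip
  have hemb := gr_embedding hc.frame ξ hC
  set ν0 := M.nu ξ
  rw [hc.integral _ (fun x hx => FVi_zero (fun h => hx (hV h)))]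
  have hgr := contDiff_gr L ν0 ξ hc.cd
  rw [← fv_flat hc.cd (v := fun y => u (gr L ν0 ξ g y)) (hu.comp (hgr.of_le (by norm_num)))
    (hs.comp_isClosedEmbedding hemb) (adjL L e) ⟪e, ν0⟫]
  refine integral_congr_ae (Filter.Eventually.of_forall fun y => ?_)
  have hud := hu.differentiable (by simp)
  have hgd : DifferentiableAt ℝ g y := hc.cd.differentiable (by simp) y
  beta_reduce
  rw [← chart_deriv hc.frame ξ hgd (hud _), ← frame_decomp hc.frame e]
  have h4 := grN_inner hc.frame g y (adjL L e) ⟪e, ν0⟫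
  rw [← frame_decomp hc.frame e] at h4
  by_cases hy : gr L ν0 ξ g y ∈ V
  · have hnu := hc.nu y hy
    have hH : meanCurv M (gr L ν0 ξ g y) = - divE (grQ g) y := by
      refine meanCurv_chart hc.frame ξ hc.cd (nu_diff M _) ?_
      filter_upwards [hgr.continuous.continuousAt.eventually (hc.opn.mem_nhds hy)] with z hz
      exact hc.nu z hz
    rw [FVi, tgrad_inner, hnu, hH, ← h4]; ring
  · have hy' : gr L ν0 ξ g y ∉ tsupport u := fun h => hy (hV h)
    rw [FVi_zero hy', image_eq_zero_of_notMem_tsupport hy']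
    have : fderiv ℝ u (gr L ν0 ξ g y) = 0 := by
      by_contra hne
      exact hy' (support_fderiv_subset ℝ hne)
    change grW g y * 0 = grW g y * (fderiv ℝ u (gr L ν0 ξ g y)) _ + 0 * _
    rw [this]; simp

structure Adm (M : Hypersurface n) (u : Eu n → ℝ) : Prop where
  cd : ContDiff ℝ 1 u
  cs : HasCompactSupport u
  cK : IsCompact (M.carrier ∩ tsupport u)

lemma Adm.mul {M : Hypersurface n} {u v : Eu n → ℝ} (h : Adm M u) (hv : ContDiff ℝ 1 v) :
    Adm M (fun x => v x * u x) := by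
  have hsub : tsupport (fun x => v x * u x) ⊆ tsupport u :=
    closure_mono fun x hx h0 => hx (by simp [h0])
  refine ⟨hv.mul h.cd, h.cs.mul_left, ?_⟩
  have : M.carrier ∩ tsupport (fun x => v x * u x) =
      (M.carrier ∩ tsupport u) ∩ tsupport (fun x => v x * u x) := by
    ext x; constructor
    · rintro ⟨h1, h2⟩; exact ⟨⟨h1, hsub h2⟩, h2⟩
    · rintro ⟨⟨h1, _⟩, h2⟩; exact ⟨h1, h2⟩
  rw [this]
  exact h.cK.inter_right (isClosed_tsupport _)

lemma Adm.integrable {M : Hypersurface n} {u : Eu n → ℝ} (h : Adm M u) {F : Eu n → ℝ}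
    (hF : Continuous F) (h0 : ∀ x ∉ tsupport u, F x = 0) : Integrable F (surfMeasure M) :=
  integrable_cont M h.cK Set.inter_subset_left hF.continuousOn (fun x hx hx' => h0 x fun h => hx' ⟨hx, h⟩)

lemma surf_congr (M : Hypersurface n) {F G : Eu n → ℝ} (h : ∀ x ∈ M.carrier, F x = G x) :
    ∫ x, F x ∂surfMeasure M = ∫ x, G x ∂surfMeasure M :=
  setIntegral_congr_fun (measM M) h

lemma FVi_congr {M : Hypersurface n} {u v : Eu n → ℝ} {e x : Eu n} (h : u =ᶠ[nhds x] v) :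
    FVi M u e x = FVi M v e x := by
  rw [FVi, FVi, tgrad_inner, tgrad_inner, h.fderiv_eq, h.eq_of_nhds]

lemma FVi_sum {ι : Type*} {M : Hypersurface n} (s : Finset ι) {u : ι → Eu n → ℝ} {e x : Eu n}
    (hu : ∀ i, Differentiable ℝ (u i)) :
    FVi M (fun y => ∑ i ∈ s, u i y) e x = ∑ i ∈ s, FVi M (u i) e x := by
  simp only [FVi, tgrad_inner]
  rw [fderiv_fun_sum (fun i _ => hu i x), Finset.sum_sub_distrib, Finset.mul_sum]
  simp

lemma fv_global {M : Hypersurface n} {u : Eu n → ℝ} (h : Adm M u) (e : Eu n) :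
    ∫ x, FVi M u e x ∂surfMeasure M = 0 := by
  have hch : ∀ ξ : M.carrier, ∃ L g V, IsChart M ξ L g V := fun ξ => exists_chart M ξ.2
  choose L g V hc using hch
  obtain ⟨t, ht⟩ := h.cK.elim_finite_subcover V (fun i => (hc i).opn)
    (fun x hx => Set.mem_iUnion.2 ⟨⟨x, hx.1⟩, (hc ⟨x, hx.1⟩).mem⟩)
  obtain ⟨K', hK', hKK', hK'V⟩ := exists_compact_between h.cK
    (isOpen_biUnion fun i (_ : i ∈ t) => (hc i).opn) ht
  obtain ⟨f, hf⟩ := SmoothPartitionOfUnity.exists_isSubordinate (modelWithCornersSelf ℝ (Eu n))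
    hK'.isClosed (fun i : t => V i) (fun i => (hc i).opn) (by
      intro x hx
      obtain ⟨i, hi, hx'⟩ := Set.mem_iUnion₂.1 (hK'V hx)
      exact Set.mem_iUnion.2 ⟨⟨i, hi⟩, hx'⟩)
  have hfc : ∀ i, ContDiff ℝ 1 (f i) := fun i =>
    (f i).contMDiff.contDiff.of_le (by exact_mod_cast le_top)
  have hA : ∀ i, Adm M (fun x => f i x * u x) := fun i => h.mul (hfc i)
  have hmain : ∀ x ∈ M.carrier, FVi M u e x = ∑ i, FVi M (fun x => f i x * u x) e x := by
    intro x hx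
    rw [← FVi_sum Finset.univ (fun i => (hA i).cd.differentiable (by simp))]
    refine FVi_congr ?_
    by_cases hxu : x ∈ tsupport u
    · filter_upwards [isOpen_interior.mem_nhds (hKK' ⟨hx, hxu⟩)] with z hz
      rw [← Finset.sum_mul, ← finsum_eq_sum_of_fintype, f.sum_eq_one (interior_subset hz), one_mul]
    · filter_upwards [notMem_tsupport_iff_eventuallyEq.1 hxu] with z hz
      simp [hz]
  rw [surf_congr M hmain, integral_finsetSum]
  · refine Finset.sum_eq_zero fun i _ => ?_
    refine fv_local (hc i) (hA i).cd (hA i).cs ?_ e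
    have : tsupport (fun x => f i x * u x) ⊆ tsupport (f i) :=
      closure_mono fun x hx h0 => hx (by simp [h0])
    exact this.trans (hf i)
  · intro i _
    exact (hA i).integrable (cont_FVi M (hA i).cd e) (fun x hx => FVi_zero hx)

lemma fv_vec {M : Hypersurface n} {u : Eu n → ℝ} (h : Adm M u) (ξ : Eu n) :
    ∫ x, (⟪tgrad M.nu u x, x - ξ⟫ + n * u x - meanCurv M x * u x * ⟪M.nu x, x - ξ⟫) ∂surfMeasure M = 0 := by
  let b := EuclideanSpace.basisFun (Fin (n + 1)) ℝ
  have hcd : ∀ i, ContDiff ℝ 1 (fun x => ⟪b i, x - ξ⟫) := fun i =>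
    contDiff_const.inner ℝ (contDiff_id.sub contDiff_const)
  have hA : ∀ i, Adm M (fun x => ⟪b i, x - ξ⟫ * u x) := fun i => h.mul (hcd i)
  have hsum : ∑ i, ∫ x, FVi M (fun x => ⟪b i, x - ξ⟫ * u x) (b i) x ∂surfMeasure M = 0 :=
    Finset.sum_eq_zero fun i _ => fv_global (hA i) (b i)
  rw [← integral_finsetSum _ (fun i _ => (hA i).integrable (cont_FVi M (hA i).cd _)
    (fun x hx => FVi_zero hx))] at hsum
  rw [← hsum]
  refine surf_congr M fun x hx => ?_
  have hN := M.unit_nu x hx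
  have hud := h.cd.differentiable (by simp) x
  have hd : ∀ i w, fderiv ℝ (fun x => ⟪b i, x - ξ⟫ * u x) x w =
      ⟪b i, x - ξ⟫ * fderiv ℝ u x w + u x * ⟪b i, w⟫ := by
    intro i w
    have h1 : HasFDerivAt (fun x => ⟪b i, x - ξ⟫) (innerSL ℝ (b i)) x :=
      (innerSL ℝ (b i)).hasFDerivAt.comp x ((hasFDerivAt_id x).sub_const ξ)
    have h2 : HasFDerivAt (fun x => ⟪b i, x - ξ⟫ * u x) _ x := h1.mul hud.hasFDerivAt
    rw [h2.fderiv]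
    simp
  have hterm : ∀ i, FVi M (fun x => ⟪b i, x - ξ⟫ * u x) (b i) x =
      ⟪tgrad M.nu u x, b i⟫ * ⟪b i, x - ξ⟫ + u x * (1 - ⟪M.nu x, b i⟫ * ⟪b i, M.nu x⟫)
        - meanCurv M x * u x * (⟪M.nu x, b i⟫ * ⟪b i, x - ξ⟫) := by
    intro i
    have hb : ⟪b i, tP (M.nu x) (b i)⟫ = 1 - ⟪M.nu x, b i⟫ * ⟪b i, M.nu x⟫ := by
      rw [tP_apply, inner_sub_right, real_inner_smul_right, real_inner_self_eq_norm_sq, b.norm_eq_one]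
      norm_num
    rw [FVi, tgrad_inner, tgrad_inner, hd, hb]; ring
  simp only [hterm]
  rw [Finset.sum_sub_distrib, Finset.sum_add_distrib, b.sum_inner_mul_inner, ← Finset.mul_sum,
    ← Finset.mul_sum, Finset.sum_sub_distrib, b.sum_inner_mul_inner, b.sum_inner_mul_inner,
    real_inner_self_eq_norm_sq, hN]
  simp
  ring

lemma exists_cutoff : ∃ (η η' : ℝ → ℝ) (A : ℝ), 0 ≤ A ∧ (∀ s, HasDerivAt η (η' s) s) ∧
    Continuous η' ∧ (∀ s, 0 ≤ η s ∧ η s ≤ 1) ∧ (∀ s, η' s ≤ 0 ∧ -A ≤ η' s) ∧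
    (∀ s ≤ 1/4, η s = 1 ∧ η' s = 0) ∧ (∀ s, 1 ≤ s → η s = 0 ∧ η' s = 0) := by
  have hsm : ContDiff ℝ 1 Real.smoothTransition := Real.smoothTransition.contDiff
  have hst : ∀ t, HasDerivAt Real.smoothTransition (deriv Real.smoothTransition t) t := fun t =>
    ((hsm.differentiable (by simp)) t).hasDerivAt
  have hcont : Continuous (deriv Real.smoothTransition) := hsm.continuous_deriv (by simp)
  have hnn : ∀ t, 0 ≤ deriv Real.smoothTransition t := fun t => Real.smoothTransition.monotone.deriv_nonneg
  have h0 : ∀ t ≤ 0, deriv Real.smoothTransition t = 0 := by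
    intro t ht
    refine (IsLocalMin.deriv_eq_zero ?_)
    refine Filter.Eventually.of_forall fun z => ?_
    rw [Real.smoothTransition.zero_of_nonpos ht]; exact Real.smoothTransition.nonneg z
  have h1 : ∀ t, 1 ≤ t → deriv Real.smoothTransition t = 0 := by
    intro t ht
    refine (IsLocalMax.deriv_eq_zero ?_)
    refine Filter.Eventually.of_forall fun z => ?_
    rw [Real.smoothTransition.one_of_one_le ht]; exact Real.smoothTransition.le_one z
  obtain ⟨A, hA⟩ := isCompact_Icc.exists_bound_of_continuousOn (s := Set.Icc (0:ℝ) 1) hcont.continuousOn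
  have hA0 : 0 ≤ A := (norm_nonneg _).trans (hA 0 (by simp))
  have hb : ∀ t, deriv Real.smoothTransition t ≤ A := by
    intro t
    by_cases ht : t ∈ Set.Icc (0:ℝ) 1
    · exact (le_abs_self _).trans (hA t ht)
    · rw [Set.mem_Icc, not_and_or] at ht
      rcases ht with ht | ht
      · rw [h0 t (by linarith)]; exact hA0
      · rw [h1 t (by linarith)]; exact hA0
  refine ⟨fun s => Real.smoothTransition (2 - 2 * s), fun s => deriv Real.smoothTransition (2 - 2 * s) * (-2),
    2 * A, by positivity, ?_, by fun_prop, ?_, ?_, ?_, ?_⟩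
  · intro s
    have : HasDerivAt (fun s : ℝ => 2 - 2 * s) (-2) s := by
      simpa using ((hasDerivAt_id s).const_mul 2).const_sub 2
    exact (hst _).comp s this
  · exact fun s => ⟨Real.smoothTransition.nonneg _, Real.smoothTransition.le_one _⟩
  · intro s
    have := hnn (2 - 2 * s); have := hb (2 - 2 * s)
    constructor <;> nlinarith
  · intro s hs
    refine ⟨Real.smoothTransition.one_of_one_le (by linarith), ?_⟩
    beta_reduce; rw [h1 _ (by linarith)]; simp
  · intro s hs
    refine ⟨Real.smoothTransition.zero_of_nonpos (by linarith), ?_⟩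
    beta_reduce; rw [h0 _ (by linarith)]; simp

/-- The weight in the monotonicity formula. -/
def kk (M : Hypersurface n) (h : Eu n → ℝ) (x : Eu n) : ℝ := ‖tgrad M.nu h x‖ + |meanCurv M x| * h x

lemma cont_kk (M : Hypersurface n) {u : Eu n → ℝ} (hu : ContDiff ℝ 1 u) : Continuous (kk M u) := by
  have h1 := cont_tgrad M hu
  have h2 := cont_H M
  have h4 := hu.continuous
  unfold kk
  fun_prop

lemma kk_zero {M : Hypersurface n} {u : Eu n → ℝ} {x : Eu n} (h : x ∉ tsupport u) :
    kk M u x = 0 := by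
  rw [kk, tgrad_zero_of h, image_eq_zero_of_notMem_tsupport h]; simp

lemma radial_deriv {G G' : ℝ → ℝ} (hG : ∀ s, 0 ≤ s → HasDerivAt G (G' s) s) (ξ x : Eu n) :
    HasFDerivAt (fun x => G (‖x - ξ‖ ^ 2)) ((2 * G' (‖x - ξ‖ ^ 2)) • innerSL ℝ (x - ξ)) x := by
  have h1 : HasFDerivAt (fun x : Eu n => ‖x - ξ‖ ^ 2) (2 • innerSL ℝ (x - ξ)) x := by
    have := ((hasStrictFDerivAt_norm_sq (x - ξ)).hasFDerivAt).comp x ((hasFDerivAt_id x).sub_const ξ)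
    exact this
  have h2 := (hG (‖x - ξ‖ ^ 2) (by positivity)).comp_hasFDerivAt x h1
  convert! h2 using 1
  ext1 w
  simp
  ring

lemma radial_contDiff {G G' : ℝ → ℝ} (hG : ∀ s, 0 ≤ s → HasDerivAt G (G' s) s)
    (hG' : ContinuousOn G' (Set.Ici 0)) (ξ : Eu n) : ContDiff ℝ 1 (fun x => G (‖x - ξ‖ ^ 2)) := by
  rw [contDiff_one_iff_fderiv]
  refine ⟨fun x => (radial_deriv hG ξ x).differentiableAt, ?_⟩
  have : fderiv ℝ (fun x => G (‖x - ξ‖ ^ 2)) = fun x => (2 * G' (‖x - ξ‖ ^ 2)) • innerSL ℝ (x - ξ) := by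
    ext1 x; exact (radial_deriv hG ξ x).fderiv
  rw [this]
  have h1 : Continuous fun x : Eu n => G' (‖x - ξ‖ ^ 2) :=
    hG'.comp_continuous (by fun_prop) (fun x => by simp)
  exact (continuous_const.mul h1).smul ((innerSL ℝ).continuous.comp (continuous_id.sub continuous_const))

lemma fv_ineq {M : Hypersurface n} {h : Eu n → ℝ} (hA : Adm M h) (h0 : ∀ x, 0 ≤ h x) (ξ : Eu n)
    {G G' : ℝ → ℝ} (hG : ∀ s, 0 ≤ s → HasDerivAt G (G' s) s) (hG' : ContinuousOn G' (Set.Ici 0))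
    (hp : ∀ s, 0 ≤ s → 0 ≤ G s) (hn : ∀ s, 0 ≤ s → G' s ≤ 0) :
    ∫ x, h x * (2 * ‖x - ξ‖ ^ 2 * G' (‖x - ξ‖ ^ 2) + n * G (‖x - ξ‖ ^ 2)) ∂surfMeasure M ≤
      ∫ x, G (‖x - ξ‖ ^ 2) * ‖x - ξ‖ * kk M h x ∂surfMeasure M := by
  have hcd := radial_contDiff hG hG' ξ
  have hB := hA.mul hcd
  have hGc := hcd.continuous
  have hG'c : Continuous fun x : Eu n => G' (‖x - ξ‖ ^ 2) :=
    hG'.comp_continuous (by fun_prop) (fun x => by simp)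
  have hhc := hA.cd.continuous
  have hX0 : Continuous fun x : Eu n => x - ξ := by fun_prop
  have hX1 : Continuous fun x : Eu n => ‖x - ξ‖ := by fun_prop
  have hX2 : Continuous fun x : Eu n => ‖x - ξ‖ ^ 2 := by fun_prop
  have hkc := cont_kk M hA.cd
  have I1 : Integrable (fun x => h x * (2 * ‖x - ξ‖ ^ 2 * G' (‖x - ξ‖ ^ 2) + n * G (‖x - ξ‖ ^ 2)))
      (surfMeasure M) := hA.integrable (hhc.mul (((continuous_const.mul hX2).mul hG'c).add
        (continuous_const.mul hGc))) (fun x hx => by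
        rw [image_eq_zero_of_notMem_tsupport hx]; simp)
  have I2 : Integrable (fun x => G (‖x - ξ‖ ^ 2) * ‖x - ξ‖ * kk M h x) (surfMeasure M) :=
    hA.integrable ((hGc.mul hX1).mul hkc) (fun x hx => by rw [kk_zero hx]; simp)
  rw [← sub_nonpos, ← integral_sub I1 I2, ← fv_vec hB ξ]
  refine integral_mono_ae (I1.sub I2) ?_ ?_
  · refine hA.integrable ?_ fun x hx => ?_
    · have h1 := cont_tgrad M hB.cd
      have h2 := cont_H M
      have h3 := M.smooth_nu.continuous
      exact ((h1.inner hX0).add (continuous_const.mul (hGc.mul hhc))).sub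
        ((h2.mul (hGc.mul hhc)).mul (h3.inner hX0))
    · have hsub : tsupport (fun x => G (‖x - ξ‖ ^ 2) * h x) ⊆ tsupport h :=
        closure_mono fun y hy h0 => hy (by simp [h0])
      have hx' : x ∉ tsupport (fun x => G (‖x - ξ‖ ^ 2) * h x) := fun h' => hx (hsub h')
      rw [tgrad_zero_of hx', image_eq_zero_of_notMem_tsupport hx]; simp
  · refine ae_restrict_of_forall_mem (measM M) fun x hx => ?_
    beta_reduce
    have hN := M.unit_nu x hx
    have hd : DifferentiableAt ℝ h x := hA.cd.differentiable (by simp) x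
    have h2 : HasFDerivAt (fun x => G (‖x - ξ‖ ^ 2) * h x) _ x := (radial_deriv hG ξ x).mul hd.hasFDerivAt
    rw [tgrad_inner, h2.fderiv]
    set X := x - ξ with hX
    set s := ‖X‖ ^ 2 with hs
    have hs0 : 0 ≤ s := by positivity
    have e1 : ⟪X, tP (M.nu x) X⟫ = s - ⟪M.nu x, X⟫ ^ 2 := by
      rw [tP_apply, inner_sub_right, real_inner_smul_right, real_inner_self_eq_norm_sq, real_inner_comm]
      ring
    have e2 : fderiv ℝ h x (tP (M.nu x) X) = ⟪tgrad M.nu h x, X⟫ := (tgrad_inner _ _ _ _).symm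
    simp only [_root_.add_apply, _root_.smul_apply, smul_eq_mul, innerSL_apply_apply, e1, e2]
    have b1 : -(‖tgrad M.nu h x‖ * ‖X‖) ≤ ⟪tgrad M.nu h x, X⟫ := (abs_le.1 (abs_real_inner_le_norm _ _)).1
    have b2 : |⟪M.nu x, X⟫| ≤ ‖X‖ := by
      have := abs_real_inner_le_norm (M.nu x) X
      rwa [hN, one_mul] at this
    have b3 : meanCurv M x * ⟪M.nu x, X⟫ ≤ |meanCurv M x| * ‖X‖ := by
      refine (le_abs_self _).trans ?_
      rw [abs_mul]; gcongr
    have hGs := hp s hs0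
    have hG's := hn s hs0
    have hh := h0 x
    have c1 : G s * (-(‖tgrad M.nu h x‖ * ‖X‖)) ≤ G s * ⟪tgrad M.nu h x, X⟫ := by gcongr
    have c2 : (G s * h x) * (meanCurv M x * ⟪M.nu x, X⟫) ≤ (G s * h x) * (|meanCurv M x| * ‖X‖) := by gcongr
    have c3 : 0 ≤ h x * (-G' s) * ⟪M.nu x, X⟫ ^ 2 := by
      have : 0 ≤ -G' s := by linarith
      positivity
    unfold kk
    linarith

lemma wt_deriv {τ : ℝ} (hτ : 0 < τ) {k : ℕ} (hk : 1 ≤ k) {s : ℝ} (hs : 0 ≤ s) :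
    HasDerivAt (fun s => ((√(s + τ ^ 2)) ^ k)⁻¹) (-(k / 2 * ((√(s + τ ^ 2)) ^ (k + 2))⁻¹)) s := by
  obtain ⟨m, rfl⟩ : ∃ m, k = m + 1 := ⟨k - 1, by omega⟩
  have hp : 0 < s + τ ^ 2 := by positivity
  have ha : 0 < √(s + τ ^ 2) := Real.sqrt_pos.2 hp
  have h1 : HasDerivAt (fun s : ℝ => √(s + τ ^ 2)) (1 / (2 * √(s + τ ^ 2))) s :=
    ((hasDerivAt_id s).add_const (τ ^ 2)).sqrt hp.ne'
  have h2 := (h1.pow (m + 1)).inv (pow_pos ha _).ne'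
  convert! h2 using 1
  simp only [Nat.add_sub_cancel]
  push_cast
  simp only [Pi.pow_apply]
  field_simp
  try ring

lemma dyadic_find {r τ : ℝ} (N : ℕ) (h : r ≤ 2 ^ N * τ) :
    ∃ j ≤ N, r ≤ 2 ^ j * τ ∧ (j = 0 ∨ 2 ^ j * τ < 2 * r) := by
  classical
  have hex : ∃ j, r ≤ 2 ^ j * τ := ⟨N, h⟩
  refine ⟨Nat.find hex, Nat.find_min' hex h, Nat.find_spec hex, ?_⟩
  rcases Nat.eq_zero_or_pos (Nat.find hex) with h0 | h0
  · exact Or.inl h0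
  · right
    have := Nat.find_min hex (m := Nat.find hex - 1) (by omega)
    obtain ⟨j, hj⟩ : ∃ j, Nat.find hex = j + 1 := ⟨Nat.find hex - 1, by omega⟩
    rw [hj] at this ⊢
    simp only [Nat.add_sub_cancel, not_le] at this
    rw [pow_succ]; linarith

lemma mono_main (n : ℕ) (hn : 1 ≤ n) : ∃ C : ℝ, 0 < C ∧ ∀ (M : Hypersurface n) (h : Eu n → ℝ),
    Adm M h → (∀ x, 0 ≤ h x) → ∀ (ξ : Eu n) (τ : ℝ) (N : ℕ), 0 < τ → 1 ≤ N →
    (τ ^ n)⁻¹ * ∫ x in Metric.closedBall ξ τ, h x ∂surfMeasure M ≤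
      C * ((2 ^ N * τ) ^ n)⁻¹ * ∫ x in Metric.closedBall ξ (2 ^ N * τ), h x ∂surfMeasure M +
      C * ∑ j ∈ Finset.range (N + 1), ((2 ^ j * τ) ^ (n - 1))⁻¹ *
        ∫ x in Metric.closedBall ξ (2 ^ j * τ), kk M h x ∂surfMeasure M := by
  obtain ⟨η, η', A, hA0, hη, hη'c, hη01, hη'b, hηin, hηout⟩ := exists_cutoff
  have hηc : Continuous η := continuous_iff_continuousAt.2 fun s => (hη s).continuousAt
  set C1 : ℝ := 2 * A * 2 ^ n with hC1
  have hC1p : 0 ≤ C1 := by positivity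
  refine ⟨2 ^ (n + 2) * (C1 + 2 ^ n), by positivity, ?_⟩
  intro M h hA h0 ξ τ N hτ hN
  set ρ : ℝ := 2 ^ N * τ with hρ
  have hρp : 0 < ρ := by positivity
  have hτρ : 2 * τ ≤ ρ := by
    have : (2 : ℝ) ^ 1 ≤ 2 ^ N := pow_le_pow_right₀ (by norm_num) hN
    rw [hρ]; nlinarith
  let a : ℝ → ℝ := fun s => √(s + τ ^ 2)
  let G : ℝ → ℝ := fun s => η (s / ρ ^ 2) * ((a s) ^ n)⁻¹
  let G' : ℝ → ℝ := fun s => η' (s / ρ ^ 2) * (1 / ρ ^ 2) * ((a s) ^ n)⁻¹ +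
    η (s / ρ ^ 2) * (-(n / 2 * ((a s) ^ (n + 2))⁻¹))
  have hap : ∀ s, 0 ≤ s → 0 < a s := fun s hs => Real.sqrt_pos.2 (by positivity)
  have hG : ∀ s, 0 ≤ s → HasDerivAt G (G' s) s := by
    intro s hs
    have h1 : HasDerivAt (fun s => η (s / ρ ^ 2)) (η' (s / ρ ^ 2) * (1 / ρ ^ 2)) s :=
      (hη _).comp s ((hasDerivAt_id s).div_const _)
    exact h1.mul (wt_deriv hτ hn hs)
  have hG'c : ContinuousOn G' (Set.Ici 0) := by
    have hac : Continuous a := by fun_prop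
    have hne : ∀ k : ℕ, ∀ s ∈ Set.Ici (0:ℝ), (a s) ^ k ≠ 0 := fun k s hs => (pow_pos (hap s hs) k).ne'
    have hi : ∀ k : ℕ, ContinuousOn (fun s => ((a s) ^ k)⁻¹) (Set.Ici 0) := fun k =>
      (hac.pow k).continuousOn.inv₀ (hne k)
    have q : Continuous fun s : ℝ => s / ρ ^ 2 := by fun_prop
    exact (((hη'c.comp q).continuousOn.mul continuousOn_const).mul (hi n)).add
      ((hηc.comp q).continuousOn.mul (continuousOn_const.mul (hi (n + 2))).neg)
  have hGp : ∀ s, 0 ≤ s → 0 ≤ G s := fun s hs =>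
    mul_nonneg (hη01 _).1 (inv_nonneg.2 (pow_nonneg (hap s hs).le _))
  have hG'n : ∀ s, 0 ≤ s → G' s ≤ 0 := by
    intro s hs
    have e1 : 0 ≤ ((a s) ^ n)⁻¹ := inv_nonneg.2 (pow_nonneg (hap s hs).le _)
    have e2 : 0 ≤ ((a s) ^ (n + 2))⁻¹ := inv_nonneg.2 (pow_nonneg (hap s hs).le _)
    have e3 : 0 ≤ (-η' (s / ρ ^ 2)) * (1 / ρ ^ 2) * ((a s) ^ n)⁻¹ := by
      have := (hη'b (s / ρ ^ 2)).1
      have : 0 ≤ -η' (s / ρ ^ 2) := by linarith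
      positivity
    have e4 : 0 ≤ η (s / ρ ^ 2) * (n / 2 * ((a s) ^ (n + 2))⁻¹) := by
      have := (hη01 (s / ρ ^ 2)).1
      positivity
    simp only [G']; linarith
  have key := fv_ineq hA h0 ξ hG hG'c hGp hG'n
  -- integrability
  have Ih : Integrable h (surfMeasure M) := hA.integrable hA.cd.continuous
    (fun x hx => image_eq_zero_of_notMem_tsupport hx)
  have Ik : Integrable (kk M h) (surfMeasure M) := hA.integrable (cont_kk M hA.cd)
    (fun x hx => kk_zero hx)
  have mB : ∀ r, MeasurableSet (Metric.closedBall ξ r) := fun r => measurableSet_closedBall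
  have hcd := radial_contDiff hG hG'c ξ
  have hG'c' : Continuous fun x : Eu n => G' (‖x - ξ‖ ^ 2) :=
    hG'c.comp_continuous (by fun_prop) (fun x => by simp)
  have hX1 : Continuous fun x : Eu n => ‖x - ξ‖ := by fun_prop
  have hX2 : Continuous fun x : Eu n => ‖x - ξ‖ ^ 2 := by fun_prop
  have hk0 : ∀ x, 0 ≤ kk M h x := fun x => by
    have := h0 x
    unfold kk; positivity
  -- lower bound
  have low : (2 ^ (n + 2))⁻¹ * (τ ^ n)⁻¹ * ∫ x in Metric.closedBall ξ τ, h x ∂surfMeasure M -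
      C1 * (ρ ^ n)⁻¹ * ∫ x in Metric.closedBall ξ ρ, h x ∂surfMeasure M ≤
      ∫ x, h x * (2 * ‖x - ξ‖ ^ 2 * G' (‖x - ξ‖ ^ 2) + n * G (‖x - ξ‖ ^ 2)) ∂surfMeasure M := by
    rw [← integral_indicator (mB τ), ← integral_indicator (mB ρ), ← integral_const_mul, ← integral_const_mul,
      ← integral_sub ((Ih.indicator (mB τ)).const_mul _) ((Ih.indicator (mB ρ)).const_mul _)]
    refine integral_mono (((Ih.indicator (mB τ)).const_mul _).sub ((Ih.indicator (mB ρ)).const_mul _)) ?_ ?_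
    · exact hA.integrable (hA.cd.continuous.mul (((continuous_const.mul hX2).mul hG'c').add
        (continuous_const.mul hcd.continuous))) (fun x hx => by
          rw [image_eq_zero_of_notMem_tsupport hx]; simp)
    · intro x
      beta_reduce
      set s := ‖x - ξ‖ ^ 2 with hs
      have hs0 : 0 ≤ s := by positivity
      have ha := hap s hs0
      have ha2 : a s ^ 2 = s + τ ^ 2 := Real.sq_sqrt (by positivity)
      have hh := h0 x
      have hid : 2 * s * G' s + n * G s = η (s / ρ ^ 2) * (n * τ ^ 2 * ((a s) ^ (n + 2))⁻¹) +
          2 * (s / ρ ^ 2) * η' (s / ρ ^ 2) * ((a s) ^ n)⁻¹ := by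
        have e1 : ((a s) ^ n)⁻¹ = (s + τ ^ 2) * ((a s) ^ (n + 2))⁻¹ := by
          rw [← ha2, pow_add]; field_simp
        simp only [G', G]
        rw [e1]; ring
      have d1 : (Metric.closedBall ξ τ).indicator (fun _ => (2 ^ (n + 2))⁻¹ * (τ ^ n)⁻¹) x ≤
          η (s / ρ ^ 2) * (n * τ ^ 2 * ((a s) ^ (n + 2))⁻¹) := by
        by_cases hx : x ∈ Metric.closedBall ξ τ
        · rw [Set.indicator_of_mem hx]
          rw [Metric.mem_closedBall, dist_eq_norm] at hx
          have hsτ : s ≤ τ ^ 2 := by rw [hs]; gcongr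
          have h14 : s / ρ ^ 2 ≤ 1 / 4 := by
            rw [div_le_iff₀ (by positivity)]; nlinarith
          rw [(hηin _ h14).1, one_mul]
          have ha2τ : a s ≤ 2 * τ := by nlinarith
          have : ((2 * τ) ^ (n + 2))⁻¹ ≤ ((a s) ^ (n + 2))⁻¹ := by gcongr
          have hn1 : (1 : ℝ) ≤ n := by exact_mod_cast hn
          calc (2 ^ (n + 2))⁻¹ * (τ ^ n)⁻¹ = 1 * τ ^ 2 * ((2 * τ) ^ (n + 2))⁻¹ := by
                rw [mul_pow, pow_add τ]; field_simp
            _ ≤ n * τ ^ 2 * ((a s) ^ (n + 2))⁻¹ := by gcongr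
        · rw [Set.indicator_of_notMem hx]
          have := (hη01 (s / ρ ^ 2)).1
          positivity
      have d2 : -(Metric.closedBall ξ ρ).indicator (fun _ => C1 * (ρ ^ n)⁻¹) x ≤
          2 * (s / ρ ^ 2) * η' (s / ρ ^ 2) * ((a s) ^ n)⁻¹ := by
        by_cases hx1 : s / ρ ^ 2 ≤ 1 / 4
        · rw [(hηin _ hx1).2]
          have : 0 ≤ (Metric.closedBall ξ ρ).indicator (fun _ => C1 * (ρ ^ n)⁻¹) x :=
            Set.indicator_nonneg (fun _ _ => by positivity) x
          simp; exact this
        by_cases hx2 : 1 ≤ s / ρ ^ 2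
        · rw [(hηout _ hx2).2]
          have : 0 ≤ (Metric.closedBall ξ ρ).indicator (fun _ => C1 * (ρ ^ n)⁻¹) x :=
            Set.indicator_nonneg (fun _ _ => by positivity) x
          simp; exact this
        push Not at hx1 hx2
        have hx : x ∈ Metric.closedBall ξ ρ := by
          rw [Metric.mem_closedBall, dist_eq_norm]
          rw [div_lt_one (by positivity)] at hx2
          exact (lt_of_pow_lt_pow_left₀ 2 hρp.le hx2).le
        rw [Set.indicator_of_mem hx]
        have hρa : ρ / 2 ≤ a s := by
          rw [lt_div_iff₀ (by positivity)] at hx1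
          nlinarith [sq_nonneg τ]
        have i1 : ((a s) ^ n)⁻¹ ≤ ((ρ / 2) ^ n)⁻¹ := by gcongr
        have i2 : ((ρ / 2) ^ n)⁻¹ = 2 ^ n * (ρ ^ n)⁻¹ := by rw [div_pow]; field_simp
        have i3 : 2 * (s / ρ ^ 2) * (-η' (s / ρ ^ 2)) * ((a s) ^ n)⁻¹ ≤ 2 * 1 * A * (2 ^ n * (ρ ^ n)⁻¹) := by
          rw [← i2]
          have j1 := (hη'b (s / ρ ^ 2)).1
          have j2 := (hη'b (s / ρ ^ 2)).2
          have j3 : -η' (s / ρ ^ 2) ≤ A := by linarith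
          have j4 : 0 ≤ -η' (s / ρ ^ 2) := by linarith
          gcongr
        rw [hC1]; linarith
      rw [hid]
      have t1 : (Metric.closedBall ξ τ).indicator (fun x => h x) x * ((2 ^ (n + 2))⁻¹ * (τ ^ n)⁻¹) =
          h x * (Metric.closedBall ξ τ).indicator (fun _ => (2 ^ (n + 2))⁻¹ * (τ ^ n)⁻¹) x := by
        by_cases hx : x ∈ Metric.closedBall ξ τ <;> simp [hx]
      have t2 : (Metric.closedBall ξ ρ).indicator (fun x => h x) x * (C1 * (ρ ^ n)⁻¹) =
          h x * (Metric.closedBall ξ ρ).indicator (fun _ => C1 * (ρ ^ n)⁻¹) x := by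
        by_cases hx : x ∈ Metric.closedBall ξ ρ <;> simp [hx]
      have u1 := mul_le_mul_of_nonneg_left d1 hh
      have u2 := mul_le_mul_of_nonneg_left d2 hh
      rw [← t1] at u1
      rw [mul_neg, ← t2] at u2
      linarith
  -- upper bound
  have upp : ∫ x, G (‖x - ξ‖ ^ 2) * ‖x - ξ‖ * kk M h x ∂surfMeasure M ≤
      2 ^ n * ∑ j ∈ Finset.range (N + 1), ((2 ^ j * τ) ^ (n - 1))⁻¹ *
        ∫ x in Metric.closedBall ξ (2 ^ j * τ), kk M h x ∂surfMeasure M := by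
    have hI : ∀ j : ℕ, Integrable (fun x => ((2 ^ j * τ) ^ (n - 1))⁻¹ *
      (Metric.closedBall ξ (2 ^ j * τ)).indicator (kk M h) x) (surfMeasure M) := fun j =>
        (Ik.indicator (mB _)).const_mul _
    have e : ∑ j ∈ Finset.range (N + 1), ((2 ^ j * τ) ^ (n - 1))⁻¹ *
        ∫ x in Metric.closedBall ξ (2 ^ j * τ), kk M h x ∂surfMeasure M =
        ∫ x, ∑ j ∈ Finset.range (N + 1), ((2 ^ j * τ) ^ (n - 1))⁻¹ *
          (Metric.closedBall ξ (2 ^ j * τ)).indicator (kk M h) x ∂surfMeasure M := by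
      rw [integral_finsetSum _ (fun j _ => hI j)]
      refine Finset.sum_congr rfl fun j _ => ?_
      rw [integral_const_mul, integral_indicator (mB _)]
    rw [e, ← integral_const_mul]
    refine integral_mono (hA.integrable ((hcd.continuous.mul hX1).mul (cont_kk M hA.cd))
      (fun x hx => by rw [kk_zero hx]; simp)) ((integrable_finsetSum _ (fun j _ => hI j)).const_mul _) ?_
    intro x
    beta_reduce
    have hk := hk0 x
    have hsnn : ∀ j ∈ Finset.range (N + 1), 0 ≤ ((2 ^ j * τ) ^ (n - 1))⁻¹ *
          (Metric.closedBall ξ (2 ^ j * τ)).indicator (kk M h) x := by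
      intro j _
      have : 0 ≤ (Metric.closedBall ξ (2 ^ j * τ)).indicator (kk M h) x :=
        Set.indicator_nonneg (fun y _ => hk0 y) x
      positivity
    set r := ‖x - ξ‖ with hr
    have hr0 : 0 ≤ r := norm_nonneg _
    have hs0 : 0 ≤ r ^ 2 := by positivity
    have ha := hap _ hs0
    have ha2 : a (r ^ 2) ^ 2 = r ^ 2 + τ ^ 2 := Real.sq_sqrt (by positivity)
    by_cases hrρ : r ≤ ρ
    · obtain ⟨j, hjN, hj1, hj2⟩ := dyadic_find N hrρ
      have hmem : x ∈ Metric.closedBall ξ (2 ^ j * τ) := by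
        rw [Metric.mem_closedBall, dist_eq_norm]; exact hj1
      have hja : 2 ^ j * τ ≤ 2 * a (r ^ 2) := by
        rcases hj2 with rfl | hj2
        · simp; nlinarith
        · have : r ≤ a (r ^ 2) := by nlinarith
          linarith
      have hra : r ≤ a (r ^ 2) := by nlinarith
      have step : G (r ^ 2) * r ≤ 2 ^ n * ((2 ^ j * τ) ^ (n - 1))⁻¹ := by
        obtain ⟨m, hm⟩ : ∃ m, n = m + 1 := ⟨n - 1, by omega⟩
        have hm' : n - 1 = m := by omega
        rw [hm']
        calc G (r ^ 2) * r ≤ (1 * ((a (r ^ 2)) ^ n)⁻¹) * a (r ^ 2) := by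
              simp only [G]
              gcongr
              exact (hη01 _).2
          _ = ((a (r ^ 2)) ^ m)⁻¹ := by rw [hm, pow_succ]; field_simp
          _ = 2 ^ m * ((2 * a (r ^ 2)) ^ m)⁻¹ := by rw [mul_pow]; field_simp
          _ ≤ 2 ^ n * ((2 ^ j * τ) ^ m)⁻¹ := by
              gcongr
              · norm_num
              · omega
      have := Finset.single_le_sum hsnn (Finset.mem_range.2 (by omega : j < N + 1))
      rw [Set.indicator_of_mem hmem] at this
      calc G (r ^ 2) * r * kk M h x ≤ 2 ^ n * ((2 ^ j * τ) ^ (n - 1))⁻¹ * kk M h x := by gcongr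
        _ = 2 ^ n * (((2 ^ j * τ) ^ (n - 1))⁻¹ * kk M h x) := by ring
        _ ≤ _ := by gcongr
    · push Not at hrρ
      have : 1 ≤ r ^ 2 / ρ ^ 2 := by
        rw [one_le_div (by positivity)]; gcongr
      simp only [G]
      rw [(hηout _ this).1]
      simp only [zero_mul]
      exact mul_nonneg (by positivity) (Finset.sum_nonneg hsnn)
  have hfρ : 0 ≤ ∫ x in Metric.closedBall ξ ρ, h x ∂surfMeasure M := integral_nonneg h0
  have hS : 0 ≤ ∑ j ∈ Finset.range (N + 1), ((2 ^ j * τ) ^ (n - 1))⁻¹ *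
        ∫ x in Metric.closedBall ξ (2 ^ j * τ), kk M h x ∂surfMeasure M :=
    Finset.sum_nonneg fun j _ => mul_nonneg (by positivity) (integral_nonneg hk0)
  have tot := (low.trans key).trans upp
  set S := ∑ j ∈ Finset.range (N + 1), ((2 ^ j * τ) ^ (n - 1))⁻¹ *
        ∫ x in Metric.closedBall ξ (2 ^ j * τ), kk M h x ∂surfMeasure M
  set fτ := ∫ x in Metric.closedBall ξ τ, h x ∂surfMeasure M
  set fρ := ∫ x in Metric.closedBall ξ ρ, h x ∂surfMeasure M
  have h2p : (0 : ℝ) < 2 ^ (n + 2) := by positivity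
  have e1 : (τ ^ n)⁻¹ * fτ = 2 ^ (n + 2) * ((2 ^ (n + 2))⁻¹ * (τ ^ n)⁻¹ * fτ) := by field_simp
  rw [e1]
  have e2 : (2 ^ (n + 2))⁻¹ * (τ ^ n)⁻¹ * fτ ≤ C1 * (ρ ^ n)⁻¹ * fρ + 2 ^ n * S := by linarith
  have e3 : C1 * (ρ ^ n)⁻¹ * fρ ≤ (C1 + 2 ^ n) * (ρ ^ n)⁻¹ * fρ := by
    gcongr
    have : (0:ℝ) ≤ 2 ^ n := by positivity
    linarith
  have e4 : 2 ^ n * S ≤ (C1 + 2 ^ n) * S := by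
    gcongr
    linarith
  calc 2 ^ (n + 2) * ((2 ^ (n + 2))⁻¹ * (τ ^ n)⁻¹ * fτ)
      ≤ 2 ^ (n + 2) * ((C1 + 2 ^ n) * (ρ ^ n)⁻¹ * fρ + (C1 + 2 ^ n) * S) := by gcongr; linarith
    _ = _ := by ring

lemma low_dens (n : ℕ) : ∃ c : ℝ, 0 < c ∧ ∀ (M : Hypersurface n) (h : Eu n → ℝ),
    Adm M h → (∀ x, 0 ≤ h x) → ∀ ξ ∈ M.carrier, 1 ≤ h ξ → ∃ δ > 0, ∀ σ, 0 < σ → σ ≤ δ →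
      c * σ ^ n ≤ ∫ x in Metric.closedBall ξ σ, h x ∂surfMeasure M := by
  set ω : ℝ := (μH[(n : ℝ)] : Measure (En n)).real (Metric.ball 0 1) with hω
  have hωp : 0 < ω := by
    rw [hω, measureReal_def]
    exact ENNReal.toReal_pos (Metric.measure_ball_pos _ _ one_pos).ne' measure_ball_lt_top.ne
  refine ⟨ω * (1 / 2) ^ n * (1 / 2), by positivity, ?_⟩
  intro M h hA h0 ξ hξ h1
  obtain ⟨L, g, V, hc⟩ := exists_chart M hξ
  have hg0 : gr L (M.nu ξ) ξ g 0 = ξ := by simp [gr, hc.zero]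
  have hgrad : gradient g 0 = 0 := by
    have h2 := hc.nu 0 (by rw [hg0]; exact hc.mem)
    rw [hg0] at h2
    have h3 := congrArg (adjL L) h2
    rw [grN, map_sub, map_smul, adjL_nu hc.frame, adjL_map, grQ] at h3
    have h4 : (grW g 0)⁻¹ • gradient g 0 = 0 := by simpa using h3
    exact (smul_eq_zero.1 h4).resolve_left (inv_ne_zero (grW_pos g 0).ne')
  have hfd : fderiv ℝ g 0 = 0 := by
    ext w; rw [← inner_grad, hgrad]; simp
  have hsm : ∀ᶠ y in nhds (0 : En n), |g y| ≤ ‖y‖ := by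
    have hd : HasFDerivAt g (0 : En n →L[ℝ] ℝ) 0 := by
      rw [← hfd]; exact (hc.cd.differentiable (by simp) 0).hasFDerivAt
    have := hd.isLittleO.def (c := 1) one_pos
    filter_upwards [this] with y hy
    simpa [hc.zero] using hy
  have hev : ∀ᶠ x in nhds ξ, x ∈ V ∧ 1 / 2 < h x :=
    Filter.Eventually.and (hc.opn.mem_nhds hc.mem) (hA.cd.continuous.continuousAt.eventually (lt_mem_nhds (by linarith)))
  obtain ⟨d1, hd1, hb1⟩ := Metric.eventually_nhds_iff.1 hsm
  obtain ⟨d2, hd2, hb2⟩ := Metric.eventually_nhds_iff.1 hev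
  refine ⟨min (min d1 1) (d2 / 2), by positivity, fun σ hσ hσd => ?_⟩
  have hσ1 : σ ≤ d1 := hσd.trans ((min_le_left _ _).trans (min_le_left _ _))
  have hσ2 : σ ≤ 1 := hσd.trans ((min_le_left _ _).trans (min_le_right _ _))
  have hσ3 : σ ≤ d2 / 2 := hσd.trans (min_le_right _ _)
  have hB : ∀ x ∈ Metric.closedBall ξ σ, x ∈ V ∧ 1 / 2 < h x := fun x hx =>
    hb2 (by have := Metric.mem_closedBall.1 hx; linarith)
  set Γ := gr L (M.nu ξ) ξ g with hΓ
  have hsub : Γ '' Metric.closedBall 0 (σ / 2) ⊆ Metric.closedBall ξ σ ∩ M.carrier := by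
    rintro _ ⟨y, hy, rfl⟩
    have hy' : ‖y‖ ≤ σ / 2 := by simpa using hy
    have hgy : |g y| ≤ ‖y‖ := hb1 (by rw [dist_zero_right]; linarith)
    have hin : Γ y ∈ Metric.closedBall ξ σ := by
      rw [Metric.mem_closedBall, ← hg0, dist_eq_norm, gr_sub]
      refine (norm_add_le _ _).trans ?_
      rw [L.norm_map, norm_smul, hc.frame.unit, hc.zero, Real.norm_eq_abs]
      simp only [sub_zero, mul_one]; linarith
    exact ⟨hin, (hc.iff _ (hB _ hin).1).2 ⟨y, rfl⟩⟩
  have hfin : surfMeasure M (Metric.closedBall ξ σ) < ⊤ := by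
    refine lt_of_le_of_lt (measure_mono fun x hx => ?_) hc.finite
    exact ⟨(hB x hx).1, Metric.closedBall_subset_closedBall hσ2 hx⟩
  have hle : (μH[(n : ℝ)] : Measure (En n)) (Metric.closedBall 0 (σ / 2)) ≤
      surfMeasure M (Metric.closedBall ξ σ) := by
    rw [surfMeasure, Measure.restrict_apply measurableSet_closedBall]
    have := hausdorff_image_le_of_dist (id : En n → En n) Γ (Metric.closedBall 0 (σ / 2)) 1
      (fun x _ y _ => by simpa using gr_antilip hc.frame ξ g x y) (n : ℝ) (by positivity)
    rw [Set.image_id] at this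
    refine this.trans ?_
    simpa using measure_mono hsub
  have hle2 : (σ / 2) ^ n * ω ≤ (surfMeasure M).real (Metric.closedBall ξ σ) := by
    have h5 := ENNReal.toReal_mono hfin.ne hle
    have h6 := Measure.addHaar_real_closedBall (μH[(n : ℝ)] : Measure (En n)) 0 (by positivity : 0 ≤ σ / 2)
    rw [finrank_euclideanSpace_fin] at h6
    rw [hω, ← h6]; exact h5
  have hint : Integrable h (surfMeasure M) :=
    hA.integrable hA.cd.continuous (fun x hx => image_eq_zero_of_notMem_tsupport hx)
  calc ω * (1 / 2) ^ n * (1 / 2) * σ ^ n = (σ / 2) ^ n * ω * (1 / 2) := by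
        rw [div_pow, div_pow]; ring
    _ ≤ (surfMeasure M).real (Metric.closedBall ξ σ) * (1 / 2) := by gcongr
    _ = ∫ x in Metric.closedBall ξ σ, (1 / 2 : ℝ) ∂surfMeasure M := by
        rw [setIntegral_const, smul_eq_mul]
    _ ≤ _ := by
        refine setIntegral_mono_on ?_ hint.integrableOn measurableSet_closedBall
          (fun x hx => (hB x hx).2.le)
        exact integrableOn_const hfin.ne

lemma scale_sel {n : ℕ} (hn : 1 ≤ n) {C c : ℝ} (hC : 0 < C) (hc : 0 < c) :
    ∃ ε K : ℝ, 0 < ε ∧ 0 < K ∧ ∀ (f g : ℝ → ℝ) (m ρ0 δ : ℝ), (∀ r, 0 ≤ f r) → (∀ r, f r ≤ m) →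
      (∀ (τ : ℝ) (N : ℕ), 0 < τ → 1 ≤ N → (τ ^ n)⁻¹ * f τ ≤ C * ((2 ^ N * τ) ^ n)⁻¹ * f (2 ^ N * τ) +
        C * ∑ j ∈ Finset.range (N + 1), ((2 ^ j * τ) ^ (n - 1))⁻¹ * g (2 ^ j * τ)) →
      0 < δ → (∀ σ, 0 < σ → σ ≤ δ → c * σ ^ n ≤ f σ) → 0 < ρ0 → ρ0 ^ n = K * m →
      ∃ ρ, 0 < ρ ∧ ρ ≤ ρ0 ∧ f (5 * ρ) ≤ ε⁻¹ * ρ0 * g ρ := by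
  refine ⟨1 / (4 * C * 5 ^ n), 4 * (C + 1) * 2 ^ n / c, by positivity, by positivity, ?_⟩
  intro f g m ρ0 δ hf0 hfm hmono hδ hlow hρ0 hρm
  set ε : ℝ := 1 / (4 * C * 5 ^ n) with hε
  have hεp : 0 < ε := by positivity
  have hm : 0 < m := by
    have h1 : 0 < ρ0 ^ n := by positivity
    rw [hρm] at h1
    exact pos_of_mul_pos_right h1 (by positivity)
  by_contra hcon
  push Not at hcon
  have hg : ∀ ρ, 0 < ρ → ρ ≤ ρ0 → g ρ ≤ ε * ρ0⁻¹ * f (5 * ρ) := by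
    intro ρ h1 h2
    have h3 := (hcon ρ h1 h2).le
    calc g ρ = ε * ρ0⁻¹ * (ε⁻¹ * ρ0 * g ρ) := by field_simp
      _ ≤ _ := by gcongr
  set σ := min δ (ρ0 / 2) with hσ
  have hσp : 0 < σ := by positivity
  set T : Set ℝ := (fun τ => (τ ^ n)⁻¹ * f τ) '' Set.Ici σ with hT
  have hbdd : BddAbove T := by
    refine ⟨(σ ^ n)⁻¹ * m, ?_⟩
    rintro _ ⟨τ, hτ, rfl⟩
    have : σ ≤ τ := hτ
    have := hfm τ
    simp only
    gcongr
    exact hf0 τ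
  have hne : T.Nonempty := ⟨_, σ, Set.mem_Ici.2 le_rfl, rfl⟩
  set S := sSup T with hS
  have hle : ∀ τ, σ ≤ τ → f τ ≤ S * τ ^ n := by
    intro τ hτ
    have hτp : 0 < τ := hσp.trans_le hτ
    have h1 : (τ ^ n)⁻¹ * f τ ≤ S := le_csSup hbdd ⟨τ, hτ, rfl⟩
    calc f τ = (τ ^ n)⁻¹ * f τ * τ ^ n := by field_simp
      _ ≤ _ := by gcongr
  have hSc : c ≤ S := by
    have h1 := hlow σ hσp (min_le_left _ _)
    have h2 := hle σ le_rfl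
    exact le_of_mul_le_mul_right (h1.trans h2) (by positivity)
  have hSp : 0 < S := hc.trans_le hSc
  have hmρ : (ρ0 ^ n)⁻¹ * m = c / (4 * (C + 1) * 2 ^ n) := by
    rw [hρm]; field_simp
  have hmρ2 : ((ρ0 / 2) ^ n)⁻¹ * m = c / (4 * (C + 1)) := by
    rw [div_pow]
    have : (ρ0 ^ n / 2 ^ n)⁻¹ * m = 2 ^ n * ((ρ0 ^ n)⁻¹ * m) := by field_simp
    rw [this, hmρ]; field_simp
  have hlast : ∀ r, ρ0 / 2 ≤ r → (r ^ n)⁻¹ * f r ≤ c / (4 * (C + 1)) := by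
    intro r hr
    rw [← hmρ2]
    have := hfm r
    have := hf0 r
    gcongr
  have hSle : S ≤ c / 4 + S / 2 := by
    refine csSup_le hne ?_
    rintro _ ⟨τ, hτ, rfl⟩
    have hτ' : σ ≤ τ := hτ
    have hτp : 0 < τ := hσp.trans_le hτ
    simp only
    rcases le_or_gt (ρ0 / 2) τ with hcase | hcase
    · refine (hlast τ hcase).trans ?_
      have : c / (4 * (C + 1)) ≤ c / 4 := by
        gcongr; linarith
      linarith
    · obtain ⟨N0, hN0⟩ : ∃ N : ℕ, ρ0 < 2 ^ (N + 1) * τ := by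
        obtain ⟨N, hN⟩ := pow_unbounded_of_one_lt (ρ0 / τ) (one_lt_two)
        refine ⟨N, ?_⟩
        rw [div_lt_iff₀ hτp] at hN
        rw [pow_succ]; nlinarith [show (0:ℝ) < 2 ^ N * τ by positivity]
      classical
      have hex : ∃ N : ℕ, ρ0 < 2 ^ (N + 1) * τ := ⟨N0, hN0⟩
      obtain ⟨N, hN1, hN2⟩ : ∃ N : ℕ, ρ0 < 2 ^ (N + 1) * τ ∧ (N = 0 ∨ 2 ^ N * τ ≤ ρ0) := by
        refine ⟨Nat.find hex, Nat.find_spec hex, ?_⟩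
        rcases Nat.eq_zero_or_pos (Nat.find hex) with h0 | h0
        · exact Or.inl h0
        · right
          have := Nat.find_min hex (m := Nat.find hex - 1) (by omega)
          rw [Nat.sub_add_cancel h0] at this
          exact not_lt.1 this
      have hN : 1 ≤ N := by
        rcases Nat.eq_zero_or_pos N with h0 | h0
        · rw [h0] at hN1; simp at hN1; linarith
        · exact h0
      have hN2 : 2 ^ N * τ ≤ ρ0 := hN2.resolve_left (by omega)
      refine (hmono τ N hτp hN).trans ?_
      have hA : C * ((2 ^ N * τ) ^ n)⁻¹ * f (2 ^ N * τ) ≤ c / 4 := by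
        rw [mul_assoc]
        have h1 := hlast (2 ^ N * τ) (by rw [pow_succ] at hN1; linarith)
        calc _ ≤ C * (c / (4 * (C + 1))) := by gcongr
          _ ≤ c / 4 := by
            rw [mul_div_assoc', div_le_div_iff₀ (by positivity) (by positivity)]; nlinarith
      have hB : ∀ j ∈ Finset.range (N + 1), ((2 ^ j * τ) ^ (n - 1))⁻¹ * g (2 ^ j * τ) ≤
          ε * ρ0⁻¹ * 5 ^ n * S * τ * 2 ^ j := by
        intro j hj
        have hjN : j ≤ N := by simpa [Nat.lt_succ_iff] using hj
        have hj1 : (1:ℝ) ≤ 2 ^ j := one_le_pow₀ (by norm_num)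
        set r := 2 ^ j * τ with hr
        have hrp : 0 < r := by positivity
        have hrle : r ≤ ρ0 := by
          refine le_trans ?_ hN2
          rw [hr]; gcongr; norm_num
        have hστ : σ ≤ 5 * r := by rw [hr]; nlinarith
        have h2 := (hg r hrp hrle).trans (mul_le_mul_of_nonneg_left (hle (5 * r) hστ) (by positivity))
        calc (r ^ (n - 1))⁻¹ * g r ≤ (r ^ (n - 1))⁻¹ * (ε * ρ0⁻¹ * (S * (5 * r) ^ n)) := by gcongr
          _ = ε * ρ0⁻¹ * 5 ^ n * S * r := by
            obtain ⟨k, rfl⟩ : ∃ k, n = k + 1 := ⟨n - 1, by omega⟩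
            simp only [Nat.add_sub_cancel]
            clear_value r
            rw [mul_pow 5 r, pow_succ r k]; field_simp
          _ = _ := by rw [hr]; ring
      have hsum : ∑ j ∈ Finset.range (N + 1), (2 : ℝ) ^ j ≤ 2 * 2 ^ N := by
        rw [geom_sum_eq (by norm_num)]; rw [pow_succ]; norm_num; linarith
      have hBs : C * ∑ j ∈ Finset.range (N + 1), ((2 ^ j * τ) ^ (n - 1))⁻¹ * g (2 ^ j * τ) ≤ S / 2 := by
        calc _ ≤ C * ∑ j ∈ Finset.range (N + 1), ε * ρ0⁻¹ * 5 ^ n * S * τ * 2 ^ j := by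
              exact mul_le_mul_of_nonneg_left (Finset.sum_le_sum hB) hC.le
          _ = C * (ε * ρ0⁻¹ * 5 ^ n * S * τ * ∑ j ∈ Finset.range (N + 1), 2 ^ j) := by
              rw [← Finset.mul_sum]
          _ ≤ C * (ε * ρ0⁻¹ * 5 ^ n * S * τ * (2 * 2 ^ N)) := by gcongr
          _ = C * ε * ρ0⁻¹ * 5 ^ n * S * 2 * (2 ^ N * τ) := by ring
          _ ≤ C * ε * ρ0⁻¹ * 5 ^ n * S * 2 * ρ0 := by gcongr
          _ = S / 2 := by rw [hε]; field_simp; norm_num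
      linarith
  linarith

lemma kk_nonneg {M : Hypersurface n} {h : Eu n → ℝ} (h0 : ∀ x, 0 ≤ h x) (x : Eu n) : 0 ≤ kk M h x := by
  have := h0 x
  unfold kk; positivity

lemma weak_type (n : ℕ) (hn : 1 ≤ n) : ∃ C : ℝ, 0 < C ∧ ∀ (M : Hypersurface n) (h : Eu n → ℝ),
    Adm M h → (∀ x, 0 ≤ h x) →
    surfMeasure M {x | 1 ≤ h x} ≤ ENNReal.ofReal (C * (∫ x, h x ∂surfMeasure M) ^ (1 / (n : ℝ))) *
      ∫⁻ x, ENNReal.ofReal (kk M h x) ∂surfMeasure M := by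
  obtain ⟨C, hC, hmono⟩ := mono_main n hn
  obtain ⟨c, hc, hlow⟩ := low_dens n
  obtain ⟨ε, K, hε, hK, hsel⟩ := scale_sel hn hC hc
  refine ⟨ε⁻¹ * K ^ (1 / (n : ℝ)), by positivity, ?_⟩
  intro M h hA h0
  set μ := surfMeasure M with hμ
  have hn0 : (n : ℝ) ≠ 0 := by positivity
  have hint : Integrable h μ :=
    hA.integrable hA.cd.continuous (fun x hx => image_eq_zero_of_notMem_tsupport hx)
  have hintk : Integrable (kk M h) μ :=
    hA.integrable (cont_kk M hA.cd) (fun x hx => kk_zero hx)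
  set m := ∫ x, h x ∂μ with hm
  have hm0 : 0 ≤ m := integral_nonneg h0
  have hfle : ∀ (ξ : Eu n) (r : ℝ), ∫ x in Metric.closedBall ξ r, h x ∂μ ≤ m := fun ξ r =>
    setIntegral_le_integral hint (Filter.Eventually.of_forall h0)
  have hfnn : ∀ (ξ : Eu n) (r : ℝ), 0 ≤ ∫ x in Metric.closedBall ξ r, h x ∂μ := fun ξ r =>
    integral_nonneg h0
  set A : Set (Eu n) := {x | x ∈ M.carrier ∧ 1 ≤ h x} with hAdef
  have hsetA : μ {x | 1 ≤ h x} = μ A := by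
    have hmeas : MeasurableSet {x | 1 ≤ h x} := measurableSet_le measurable_const hA.cd.continuous.measurable
    have hmeas2 : MeasurableSet A := (measM M).inter hmeas
    rw [hμ, surfMeasure, Measure.restrict_apply hmeas, Measure.restrict_apply hmeas2]
    congr 1; ext x; simp [hAdef]; tauto
  rw [hsetA]
  rcases A.eq_empty_or_nonempty with hAe | ⟨ξ0, hξ0⟩
  · rw [hAe]; simp
  have hmp : 0 < m := by
    obtain ⟨δ, hδ, hl⟩ := hlow M h hA h0 ξ0 hξ0.1 hξ0.2
    exact lt_of_lt_of_le (by positivity) ((hl δ hδ le_rfl).trans (hfle _ _))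
  set ρ0 : ℝ := (K * m) ^ (1 / (n : ℝ)) with hρ0
  have hρ0p : 0 < ρ0 := by positivity
  have hρ0n : ρ0 ^ n = K * m := by
    rw [hρ0, ← Real.rpow_natCast, ← Real.rpow_mul (by positivity), one_div_mul_cancel hn0, Real.rpow_one]
  have hex : ∀ ξ : Eu n, ∃ ρ, ξ ∈ A → 0 < ρ ∧ ρ ≤ ρ0 ∧
      ∫ x in Metric.closedBall ξ (5 * ρ), h x ∂μ ≤ ε⁻¹ * ρ0 * ∫ x in Metric.closedBall ξ ρ, kk M h x ∂μ := by
    intro ξ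
    by_cases hξ : ξ ∈ A
    · obtain ⟨δ, hδ, hl⟩ := hlow M h hA h0 ξ hξ.1 hξ.2
      obtain ⟨ρ, hρ⟩ := hsel (fun r => ∫ x in Metric.closedBall ξ r, h x ∂μ)
        (fun r => ∫ x in Metric.closedBall ξ r, kk M h x ∂μ) m ρ0 δ (hfnn ξ) (hfle ξ)
        (fun τ N => hmono M h hA h0 ξ τ N) hδ hl hρ0p hρ0n
      exact ⟨ρ, fun _ => hρ⟩
    · exact ⟨0, fun h => absurd h hξ⟩
  choose ρ hρ using hex
  obtain ⟨u, huA, hud, hucov⟩ := Vitali.exists_disjoint_subfamily_covering_enlargement_closedBall A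
    (fun x => x) ρ ρ0 (fun a ha => (hρ a ha).2.1) 5 (by norm_num)
  have hucount : u.Countable := hud.countable_of_nonempty_interior fun i hi =>
    (Metric.nonempty_ball.2 (hρ i (huA hi)).1).mono Metric.ball_subset_interior_closedBall
  have hcover : A ⊆ ⋃ b ∈ u, (A ∩ Metric.closedBall b (5 * ρ b)) := by
    intro a ha
    obtain ⟨b, hb, hsub⟩ := hucov a ha
    exact Set.mem_biUnion hb ⟨ha, hsub (Metric.mem_closedBall_self (hρ a ha).1.le)⟩
  have hone : ∀ b : u, μ (A ∩ Metric.closedBall b (5 * ρ b)) ≤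
      ENNReal.ofReal (ε⁻¹ * ρ0) * ∫⁻ x in Metric.closedBall (b : Eu n) (ρ b), ENNReal.ofReal (kk M h x) ∂μ := by
    intro b
    have hb := (hρ b (huA b.2)).2.2
    calc μ (A ∩ Metric.closedBall b (5 * ρ b))
        ≤ μ.restrict (Metric.closedBall (b : Eu n) (5 * ρ b)) {x | 1 ≤ ENNReal.ofReal (h x)} := by
          rw [Measure.restrict_apply' measurableSet_closedBall]
          refine measure_mono (Set.inter_subset_inter_left _ fun x hx => ?_)
          simpa using hx.2
      _ ≤ ∫⁻ x in Metric.closedBall (b : Eu n) (5 * ρ b), ENNReal.ofReal (h x) ∂μ := by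
          simpa using mul_meas_ge_le_lintegral₀ (μ := μ.restrict (Metric.closedBall (b : Eu n) (5 * ρ b)))
            (hA.cd.continuous.measurable.ennreal_ofReal.aemeasurable) 1
      _ = ENNReal.ofReal (∫ x in Metric.closedBall (b : Eu n) (5 * ρ b), h x ∂μ) := by
          rw [ofReal_integral_eq_lintegral_ofReal hint.integrableOn (Filter.Eventually.of_forall h0)]
      _ ≤ ENNReal.ofReal (ε⁻¹ * ρ0 * ∫ x in Metric.closedBall (b : Eu n) (ρ b), kk M h x ∂μ) :=
          ENNReal.ofReal_le_ofReal hb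
      _ = _ := by
          rw [ENNReal.ofReal_mul (by positivity),
            ofReal_integral_eq_lintegral_ofReal hintk.integrableOn
              (Filter.Eventually.of_forall (kk_nonneg h0))]
  calc μ A ≤ μ (⋃ b ∈ u, (A ∩ Metric.closedBall b (5 * ρ b))) := measure_mono hcover
    _ ≤ ∑' b : u, μ (A ∩ Metric.closedBall b (5 * ρ b)) := measure_biUnion_le _ hucount _
    _ ≤ ∑' b : u, ENNReal.ofReal (ε⁻¹ * ρ0) *
        ∫⁻ x in Metric.closedBall (b : Eu n) (ρ b), ENNReal.ofReal (kk M h x) ∂μ := ENNReal.tsum_le_tsum hone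
    _ = ENNReal.ofReal (ε⁻¹ * ρ0) *
        ∫⁻ x in ⋃ b ∈ u, Metric.closedBall b (ρ b), ENNReal.ofReal (kk M h x) ∂μ := by
        rw [ENNReal.tsum_mul_left, lintegral_biUnion hucount (fun _ _ => measurableSet_closedBall) hud]
    _ ≤ ENNReal.ofReal (ε⁻¹ * ρ0) * ∫⁻ x, ENNReal.ofReal (kk M h x) ∂μ := by
        gcongr; exact Measure.restrict_le_self
    _ = _ := by
        rw [hρ0, Real.mul_rpow hK.le hm0, mul_assoc]

lemma Adm.of_support {M : Hypersurface n} {u v : Eu n → ℝ} (h : Adm M u) (hv : ContDiff ℝ 1 v)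
    (hs : ∀ x, u x = 0 → v x = 0) : Adm M v := by
  have hsub : tsupport v ⊆ tsupport u := closure_mono fun x hx h0 => hx (hs x h0)
  refine ⟨hv, h.cs.mono fun x hx h0 => hx (hs x h0), ?_⟩
  have : M.carrier ∩ tsupport v = (M.carrier ∩ tsupport u) ∩ tsupport v := by
    ext x; constructor
    · rintro ⟨h1, h2⟩; exact ⟨⟨h1, hsub h2⟩, h2⟩
    · rintro ⟨⟨h1, _⟩, h2⟩; exact ⟨h1, h2⟩
  rw [this]; exact h.cK.inter_right (isClosed_tsupport v)

lemma tgrad_comp {N : Eu n → Eu n} {u : Eu n → ℝ} {x : Eu n} (hu : DifferentiableAt ℝ u x)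
    {q : ℝ → ℝ} {q' : ℝ} (hq : HasDerivAt q q' (u x)) :
    tgrad N (fun y => q (u y)) x = q' • tgrad N u x := by
  refine ext_inner_right ℝ fun e => ?_
  have h1 : HasFDerivAt (fun y => q (u y)) (q' • fderiv ℝ u x) x :=
    hq.comp_hasFDerivAt x hu.hasFDerivAt
  rw [tgrad_inner, real_inner_smul_left, tgrad_inner, h1.fderiv]
  simp

lemma ann_exists {s : ℝ} (hs : 0 < s) : ∃ k : ℤ, (2:ℝ) ^ k ≤ s ∧ s < 2 ^ (k + 1) := by
  obtain ⟨k, hk⟩ := exists_mem_Ico_zpow hs (one_lt_two)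
  exact ⟨k, hk.1, hk.2⟩

lemma ann_sum (s : ℝ) :
    ∑' k : ℤ, (if (2:ℝ) ^ k ≤ s ∧ s < 2 ^ (k + 1) then (1 : ENNReal) else 0) ≤ 1 := by
  by_cases hs : 0 < s
  · obtain ⟨k, hk1, hk2⟩ := ann_exists hs
    rw [tsum_eq_single k]
    · simp [hk1, hk2]
    · intro j hj
      rw [if_neg]
      rintro ⟨h1, h2⟩
      have h3 : k < j + 1 := (zpow_lt_zpow_iff_right₀ (one_lt_two (α := ℝ))).1 (hk1.trans_lt h2)
      have h4 : j < k + 1 := (zpow_lt_zpow_iff_right₀ (one_lt_two (α := ℝ))).1 (h1.trans_lt hk2)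
      omega
  · have : ∀ k : ℤ, (if (2:ℝ) ^ k ≤ s ∧ s < 2 ^ (k + 1) then (1 : ENNReal) else 0) = 0 := by
      intro k
      rw [if_neg]
      rintro ⟨h1, _⟩
      exact hs (lt_of_lt_of_le (by positivity) h1)
    simp [this]

lemma geo_sum (s : ℝ) :
    ∑' k : ℤ, (if (2:ℝ) ^ k ≤ s then ENNReal.ofReal (2 ^ k) else 0) ≤ 2 * ENNReal.ofReal s := by
  by_cases hs : 0 < s
  · obtain ⟨k, hk1, hk2⟩ := ann_exists hs
    set f : ℤ → ENNReal := fun k => if (2:ℝ) ^ k ≤ s then ENNReal.ofReal (2 ^ k) else 0 with hf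
    have hinj : Function.Injective (fun j : ℕ => k - (j : ℤ)) := fun a b h => by
      simp only at h; omega
    have hsupp : Function.support f ⊆ Set.range (fun j : ℕ => k - (j : ℤ)) := by
      intro i hi
      have h1 : (2:ℝ) ^ i ≤ s := by
        by_contra h; exact hi (by simp [hf, h])
      have h2 : i < k + 1 := (zpow_lt_zpow_iff_right₀ (one_lt_two (α := ℝ))).1 (h1.trans_lt hk2)
      exact ⟨(k - i).toNat, by simp only; omega⟩
    rw [← hinj.tsum_eq hsupp]
    calc ∑' j : ℕ, f (k - (j : ℤ)) ≤ ∑' j : ℕ, ENNReal.ofReal s * (2⁻¹ : ENNReal) ^ j := by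
          refine ENNReal.tsum_le_tsum fun j => ?_
          have h1 : f (k - (j : ℤ)) ≤ ENNReal.ofReal (2 ^ (k - (j : ℤ))) := by
            simp only [hf]; split_ifs <;> simp
          refine h1.trans ?_
          have h2 : (2:ℝ) ^ (k - (j : ℤ)) = 2 ^ k * (2⁻¹) ^ j := by
            rw [zpow_sub₀ (by norm_num), zpow_natCast, inv_pow]; rfl
          rw [h2, ENNReal.ofReal_mul (by positivity), ENNReal.ofReal_pow (by norm_num),
            ENNReal.ofReal_inv_of_pos (by norm_num)]
          simp only [ENNReal.ofReal_ofNat]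
          gcongr
      _ = 2 * ENNReal.ofReal s := by
          rw [ENNReal.tsum_mul_left, ENNReal.tsum_geometric, ENNReal.one_sub_inv_two, inv_inv, mul_comm]
  · have : ∀ k : ℤ, (if (2:ℝ) ^ k ≤ s then ENNReal.ofReal (2 ^ k) else 0) = 0 := by
      intro k
      rw [if_neg]
      intro h1
      exact hs (lt_of_lt_of_le (by positivity) h1)
    simp [this]

lemma low_sum {p : ℝ} (hp : 0 < p) (s : ℝ) :
    ENNReal.ofReal s ^ p ≤ (4 : ENNReal) ^ p *
      ∑' k : ℤ, (if (2:ℝ) ^ (k + 1) ≤ s then ENNReal.ofReal (2 ^ k) ^ p else 0) := by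
  by_cases hs : 0 < s
  · obtain ⟨k, hk1, hk2⟩ := ann_exists hs
    have h1 : ENNReal.ofReal (2 ^ (k - 1)) ^ p ≤
        ∑' k : ℤ, (if (2:ℝ) ^ (k + 1) ≤ s then ENNReal.ofReal (2 ^ k) ^ p else 0) := by
      refine le_trans ?_ (ENNReal.le_tsum (k - 1))
      simp [hk1]
    refine le_trans ?_ (mul_le_mul_right h1 _)
    rw [← ENNReal.mul_rpow_of_nonneg _ _ hp.le]
    refine ENNReal.rpow_le_rpow ?_ hp.le
    have : (4 : ENNReal) = ENNReal.ofReal 4 := by simp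
    rw [this, ← ENNReal.ofReal_mul (by norm_num)]
    refine ENNReal.ofReal_le_ofReal (hk2.le.trans (le_of_eq ?_))
    rw [zpow_add₀ (by norm_num), zpow_sub₀ (by norm_num)]; norm_num; ring
  · rw [ENNReal.ofReal_of_nonpos (not_lt.1 hs), ENNReal.zero_rpow_of_pos hp]; simp

lemma exists_level : ∃ (q q' : ℝ → ℝ) (A : ℝ), 0 ≤ A ∧ (∀ s, HasDerivAt q (q' s) s) ∧ Continuous q' ∧
    (∀ s, 0 ≤ q s ∧ q s ≤ 1) ∧ (∀ s, |s| < 1 → q s = 0) ∧ (∀ s, 2 ≤ |s| → q s = 1) ∧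
    (∀ s, |q' s| ≤ A) ∧ (∀ s, |s| < 1 ∨ 2 ≤ |s| → q' s = 0) := by
  obtain ⟨η, η', A, hA0, hη, hη'c, hη01, hη'b, hηin, hηout⟩ := exists_cutoff
  have hsm : ∀ s : ℝ, |s| < 1 → s ^ 2 / 4 ≤ 1 / 4 := fun s hs => by
    have := sq_abs s
    nlinarith [abs_nonneg s]
  have hlg : ∀ s : ℝ, 2 ≤ |s| → 1 ≤ s ^ 2 / 4 := fun s hs => by
    have := sq_abs s
    nlinarith [abs_nonneg s]
  refine ⟨fun s => 1 - η (s ^ 2 / 4), fun s => -(η' (s ^ 2 / 4) * (s / 2)), A, hA0, ?_, ?_, ?_, ?_, ?_, ?_, ?_⟩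
  · intro s
    have h1 : HasDerivAt (fun s : ℝ => s ^ 2 / 4) (s / 2) s := by
      have := (hasDerivAt_pow 2 s).div_const 4
      convert! this using 1
      simp; ring
    simpa using ((hη (s ^ 2 / 4)).comp s h1).const_sub 1
  · fun_prop
  · intro s; have := hη01 (s ^ 2 / 4); constructor <;> linarith
  · intro s hs; simp [(hηin _ (hsm s hs)).1]
  · intro s hs; simp [(hηout _ (hlg s hs)).1]
  · intro s
    rcases le_or_gt 2 |s| with h | h
    · simp [(hηout _ (hlg s h)).2, hA0]
    · rw [abs_neg, abs_mul, abs_div]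
      have h1 : |η' (s ^ 2 / 4)| ≤ A := by
        have := hη'b (s ^ 2 / 4); rw [abs_le]; constructor <;> linarith
      have h2 : |s| / |2| ≤ 1 := by rw [abs_two, div_le_one (by norm_num)]; exact h.le
      calc _ ≤ A * 1 := by gcongr
        _ = A := mul_one A
  · rintro s (hs | hs)
    · simp [(hηin _ (hsm s hs)).2]
    · simp [(hηout _ (hlg s hs)).2]

lemma sobolev_adm (n : ℕ) (hn : 1 < n) : ∃ C : ℝ, 0 < C ∧ ∀ (M : Hypersurface n) (φ : Eu n → ℝ), Adm M φ →
      (∫ x, |φ x| ^ ((n : ℝ) / (n - 1)) ∂surfMeasure M) ^ (((n : ℝ) - 1) / n)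
        ≤ C * ∫ x, ‖tgrad M.nu φ x‖ + |meanCurv M x * φ x| ∂surfMeasure M := by
  obtain ⟨q, q', A, hA0, hq, hq'c, hq01, hqs, hql, hqA, hq'0⟩ := exists_level
  obtain ⟨C, hC, hweak⟩ := weak_type n hn.le
  have hn1 : (1 : ℝ) < n := by exact_mod_cast hn
  set p : ℝ := (n : ℝ) / (n - 1) with hp
  have hpp : 0 < p := div_pos (by linarith) (by linarith)
  have hpn : p = p * (1 / n) + 1 := by
    have : (n : ℝ) - 1 ≠ 0 := by linarith
    rw [hp]; field_simp; ring
  refine ⟨4 ^ p * C * (A + 2), by positivity, ?_⟩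
  intro M φ hφ
  set μ := surfMeasure M with hμ
  have hφc : Continuous φ := hφ.cd.continuous
  have hmeasφ : Measurable φ := hφc.measurable
  let e : ℤ → ENNReal := fun k => ENNReal.ofReal (2 ^ k)
  have he0 : ∀ k, e k ≠ 0 := fun k => by simp only [e, ne_eq, ENNReal.ofReal_eq_zero, not_le]; positivity
  have heT : ∀ k, e k ≠ ⊤ := fun k => ENNReal.ofReal_ne_top
  let ψ : Eu n → ENNReal := fun x => ENNReal.ofReal |φ x|
  have hψm : Measurable ψ := by fun_prop
  let a : ℤ → ENNReal := fun k => μ {x | (2:ℝ) ^ k ≤ |φ x|}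
  have hmset : ∀ k : ℤ, MeasurableSet {x | (2:ℝ) ^ k ≤ |φ x|} := fun k =>
    measurableSet_le measurable_const (by fun_prop)
  set Φ : ENNReal := ∫⁻ x, ψ x ^ p ∂μ with hΦ
  let F1 : Eu n → ENNReal := fun x => ENNReal.ofReal ‖tgrad M.nu φ x‖
  let F2 : Eu n → ENNReal := fun x => ENNReal.ofReal |meanCurv M x|
  have hF1 : Measurable F1 := by
    have := (cont_tgrad M hφ.cd).measurable
    fun_prop
  have hF2 : Measurable F2 := by
    have := (cont_H M).measurable
    fun_prop
  set Q : ENNReal := ∫⁻ x, (F1 x + F2 x * ψ x) ∂μ with hQ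
  let D : ℤ → Eu n → ENNReal := fun k x =>
    ENNReal.ofReal A * F1 x * (if (2:ℝ) ^ k ≤ |φ x| ∧ |φ x| < 2 ^ (k + 1) then 1 else 0) +
      F2 x * (if (2:ℝ) ^ k ≤ |φ x| then ENNReal.ofReal (2 ^ k) else 0)
  have hDm : ∀ k, Measurable (D k) := by
    intro k
    refine ((measurable_const.mul hF1).mul ?_).add (hF2.mul ?_)
    · refine Measurable.ite ?_ measurable_const measurable_const
      have hm1 : Measurable fun x => |φ x| := by fun_prop
      exact (hmset k).inter (measurableSet_lt hm1 measurable_const)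
    · exact Measurable.ite (hmset k) measurable_const measurable_const
  -- weak type estimate at each level
  have hstep : ∀ k : ℤ, a (k + 1) ≤ ENNReal.ofReal C * a k ^ (1 / (n : ℝ)) *
      ((e k)⁻¹ * ∫⁻ x, D k x ∂μ) := by
    intro k
    set t : ℝ := 2 ^ k with ht
    have htp : 0 < t := by positivity
    have htk : (2:ℝ) ^ (k + 1) = 2 * t := by rw [zpow_add₀ (by norm_num)]; simp; ring
    have habs : ∀ x, |φ x / t| = |φ x| / t := fun x => by rw [abs_div, abs_of_pos htp]
    let h : Eu n → ℝ := fun x => q (φ x / t)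
    have hqcd : ContDiff ℝ 1 q := by
      rw [contDiff_one_iff_deriv]
      refine ⟨fun s => (hq s).differentiableAt, ?_⟩
      have : deriv q = q' := funext fun s => (hq s).deriv
      rw [this]; exact hq'c
    have hcd : ContDiff ℝ 1 h := hqcd.comp (hφ.cd.div_const t)
    have hAd : Adm M h := hφ.of_support hcd fun x hx => hqs _ (by simp [hx])
    have hh0 : ∀ x, 0 ≤ h x := fun x => (hq01 _).1
    have hw := hweak M h hAd hh0
    have hint : Integrable h μ :=
      hAd.integrable hcd.continuous (fun x hx => image_eq_zero_of_notMem_tsupport hx)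
    have h1 : a (k + 1) ≤ μ {x | 1 ≤ h x} := by
      refine measure_mono fun x hx => ?_
      have hx' : (2:ℝ) ^ (k + 1) ≤ |φ x| := hx
      refine (hql _ ?_).ge
      rw [habs, le_div_iff₀ htp, ← htk]; exact hx'
    have h2 : ENNReal.ofReal (∫ x, h x ∂μ) ≤ a k := by
      rw [ofReal_integral_eq_lintegral_ofReal hint (Filter.Eventually.of_forall hh0)]
      have : ∀ x, ENNReal.ofReal (h x) ≤ {x | (2:ℝ) ^ k ≤ |φ x|}.indicator 1 x := by
        intro x
        by_cases hx : (2:ℝ) ^ k ≤ |φ x|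
        · rw [Set.indicator_of_mem (by exact hx)]
          simpa using (hq01 _).2
        · have : h x = 0 := hqs _ (by rw [habs, div_lt_one htp]; exact not_le.1 hx)
          simp [this]
      refine (lintegral_mono this).trans ?_
      rw [lintegral_indicator_one (hmset k)]
    have h3 : ENNReal.ofReal (C * (∫ x, h x ∂μ) ^ (1 / (n : ℝ))) ≤ ENNReal.ofReal C * a k ^ (1 / (n : ℝ)) := by
      rw [ENNReal.ofReal_mul hC.le,
        ← ENNReal.ofReal_rpow_of_nonneg (integral_nonneg hh0) (by positivity)]
      gcongr
    have h4 : ∀ x, ENNReal.ofReal (kk M h x) ≤ (e k)⁻¹ * D k x := by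
      intro x
      have htg : tgrad M.nu h x = (q' (φ x / t) / t) • tgrad M.nu φ x := by
        have := tgrad_comp (N := M.nu) (hφ.cd.differentiable (by simp) x)
          (q := fun s => q (s / t)) (q' := q' (φ x / t) / t) (by
            have := (hq (φ x / t)).comp (φ x) ((hasDerivAt_id (φ x)).div_const t)
            convert! this using 1
            simp [div_eq_mul_inv])
        exact this
      have hr : kk M h x ≤ t⁻¹ * (A * ‖tgrad M.nu φ x‖ *
          (if (2:ℝ) ^ k ≤ |φ x| ∧ |φ x| < 2 ^ (k + 1) then 1 else 0) +
          |meanCurv M x| * (if (2:ℝ) ^ k ≤ |φ x| then 2 ^ k else 0)) := by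
        have hr1 : ‖tgrad M.nu h x‖ ≤ t⁻¹ * (A * ‖tgrad M.nu φ x‖ *
            (if (2:ℝ) ^ k ≤ |φ x| ∧ |φ x| < 2 ^ (k + 1) then 1 else 0)) := by
          rw [htg, norm_smul, Real.norm_eq_abs, abs_div, abs_of_pos htp]
          split_ifs with hif
          · rw [mul_one, div_mul_eq_mul_div, div_eq_inv_mul]
            have := hqA (φ x / t)
            gcongr
          · have : q' (φ x / t) = 0 := by
              refine hq'0 _ ?_
              rw [habs, div_lt_one htp, le_div_iff₀ htp, ← htk]
              by_contra hcon
              push Not at hcon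
              exact hif hcon
            simp [this]
        have hr2 : h x ≤ t⁻¹ * (if (2:ℝ) ^ k ≤ |φ x| then 2 ^ k else 0) := by
          split_ifs with hif
          · rw [inv_mul_cancel₀ htp.ne']; exact (hq01 _).2
          · rw [mul_zero]
            exact (hqs _ (by rw [habs, div_lt_one htp]; exact not_le.1 hif)).le
        rw [kk, mul_add]
        refine add_le_add hr1 ?_
        calc |meanCurv M x| * h x ≤ |meanCurv M x| * (t⁻¹ * (if (2:ℝ) ^ k ≤ |φ x| then 2 ^ k else 0)) := by
              gcongr
          _ = _ := by ring
      refine (ENNReal.ofReal_le_ofReal hr).trans (le_of_eq ?_)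
      rw [ENNReal.ofReal_mul (by positivity), ENNReal.ofReal_inv_of_pos htp, ENNReal.ofReal_add
        (by split_ifs <;> positivity) (by split_ifs <;> positivity),
        ENNReal.ofReal_mul (by positivity), ENNReal.ofReal_mul hA0, ENNReal.ofReal_mul (by positivity)]
      simp only [D, F1, F2, e, ht]
      congr 3
      · split_ifs <;> simp
      · split_ifs <;> simp
    calc a (k + 1) ≤ _ := h1.trans hw
      _ ≤ ENNReal.ofReal C * a k ^ (1 / (n : ℝ)) * ∫⁻ x, (e k)⁻¹ * D k x ∂μ :=
        mul_le_mul' h3 (lintegral_mono h4)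
      _ = _ := by rw [lintegral_const_mul _ (hDm k)]
  have hcheb : ∀ k, e k ^ p * a k ≤ Φ := by
    intro k
    have h1 := mul_meas_ge_le_lintegral (μ := μ) (hψm.pow_const p) (e k ^ p)
    refine le_trans ?_ h1
    refine mul_le_mul_right (measure_mono fun x hx => ?_) _
    exact ENNReal.rpow_le_rpow (ENNReal.ofReal_le_ofReal hx) hpp.le
  have hstep2 : ∀ k : ℤ, e k ^ p * a (k + 1) ≤ ENNReal.ofReal C * Φ ^ (1 / (n : ℝ)) * ∫⁻ x, D k x ∂μ := by
    intro k
    have h1 : e k ^ p = (e k ^ p) ^ (1 / (n : ℝ)) * e k := by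
      conv_lhs => rw [hpn, ENNReal.rpow_add _ _ (he0 k) (heT k), ENNReal.rpow_mul, ENNReal.rpow_one]
    calc e k ^ p * a (k + 1) ≤ e k ^ p * (ENNReal.ofReal C * a k ^ (1 / (n : ℝ)) *
          ((e k)⁻¹ * ∫⁻ x, D k x ∂μ)) := by gcongr; exact hstep k
      _ = ENNReal.ofReal C * ((e k ^ p) ^ (1 / (n : ℝ)) * a k ^ (1 / (n : ℝ))) *
          ((e k * (e k)⁻¹) * ∫⁻ x, D k x ∂μ) := by
          conv_lhs => rw [h1]
          ring
      _ = ENNReal.ofReal C * (e k ^ p * a k) ^ (1 / (n : ℝ)) * ∫⁻ x, D k x ∂μ := by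
          rw [ENNReal.mul_inv_cancel (he0 k) (heT k), one_mul,
            ENNReal.mul_rpow_of_nonneg _ _ (by positivity)]
      _ ≤ _ := by
          gcongr; exact hcheb k
  have hDsum : ∑' k, ∫⁻ x, D k x ∂μ ≤ ENNReal.ofReal (A + 2) * Q := by
    rw [← lintegral_tsum (fun k => (hDm k).aemeasurable), hQ,
      ← lintegral_const_mul _ (show Measurable fun x => F1 x + F2 x * ψ x from hF1.add (hF2.mul hψm))]
    refine lintegral_mono fun x => ?_
    simp only [D]
    rw [ENNReal.tsum_add, ENNReal.tsum_mul_left, ENNReal.tsum_mul_left, mul_add]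
    have hA1 : ENNReal.ofReal A ≤ ENNReal.ofReal (A + 2) := ENNReal.ofReal_le_ofReal (by linarith)
    have hA2 : (2 : ENNReal) ≤ ENNReal.ofReal (A + 2) := by
      rw [← ENNReal.ofReal_ofNat]; exact ENNReal.ofReal_le_ofReal (by linarith)
    refine add_le_add ?_ ?_
    · calc _ ≤ ENNReal.ofReal A * F1 x * 1 := by gcongr; exact ann_sum _
        _ ≤ _ := by rw [mul_one]; gcongr
    · calc _ ≤ F2 x * (2 * ENNReal.ofReal |φ x|) := by gcongr; exact geo_sum _
        _ = 2 * (F2 x * ψ x) := by simp only [ψ]; ring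
        _ ≤ _ := by gcongr
  have hΦle : Φ ≤ (4 : ENNReal) ^ p * ∑' k, e k ^ p * a (k + 1) := by
    have h1 : ∀ k : ℤ, e k ^ p * a (k + 1) =
        ∫⁻ x, (if (2:ℝ) ^ (k + 1) ≤ |φ x| then ENNReal.ofReal (2 ^ k) ^ p else 0) ∂μ := by
      intro k
      rw [← lintegral_indicator_const (hmset (k + 1))]
      refine lintegral_congr fun x => ?_
      simp [Set.indicator_apply, e]
    have hm : ∀ k : ℤ, Measurable fun x =>
        (if (2:ℝ) ^ (k + 1) ≤ |φ x| then ENNReal.ofReal (2 ^ k) ^ p else 0) := fun k =>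
      Measurable.ite (hmset (k + 1)) measurable_const measurable_const
    simp_rw [h1]
    rw [← lintegral_tsum (fun k => (hm k).aemeasurable),
      ← lintegral_const_mul _ (Measurable.tsum hm)]
    exact lintegral_mono fun x => low_sum hpp _
  have hmain : Φ ≤ ENNReal.ofReal (4 ^ p * C * (A + 2)) * Q * Φ ^ (1 / (n : ℝ)) := by
    calc Φ ≤ (4 : ENNReal) ^ p * ∑' k, e k ^ p * a (k + 1) := hΦle
      _ ≤ (4 : ENNReal) ^ p * ∑' k, ENNReal.ofReal C * Φ ^ (1 / (n : ℝ)) * ∫⁻ x, D k x ∂μ := by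
        exact mul_le_mul_right (ENNReal.tsum_le_tsum hstep2) _
      _ = (4 : ENNReal) ^ p * (ENNReal.ofReal C * Φ ^ (1 / (n : ℝ)) * ∑' k, ∫⁻ x, D k x ∂μ) := by
        rw [ENNReal.tsum_mul_left]
      _ ≤ (4 : ENNReal) ^ p * (ENNReal.ofReal C * Φ ^ (1 / (n : ℝ)) * (ENNReal.ofReal (A + 2) * Q)) := by
        gcongr
      _ = _ := by
        rw [ENNReal.ofReal_mul (by positivity), ENNReal.ofReal_mul (by positivity),
          ← ENNReal.ofReal_rpow_of_pos (by norm_num)]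
        simp only [ENNReal.ofReal_ofNat]
        ring
  -- back to real integrals
  have hi1 : Integrable (fun x => |φ x| ^ p) μ := by
    refine hφ.integrable (hφc.abs.rpow_const fun x => Or.inr hpp.le) fun x hx => ?_
    rw [image_eq_zero_of_notMem_tsupport hx, abs_zero, Real.zero_rpow hpp.ne']
  have hi2 : Integrable (fun x => ‖tgrad M.nu φ x‖ + |meanCurv M x * φ x|) μ := by
    refine hφ.integrable ?_ fun x hx => ?_
    · exact (cont_tgrad M hφ.cd).norm.add ((cont_H M).mul hφc).abs
    · rw [image_eq_zero_of_notMem_tsupport hx, tgrad_zero_of hx]; simp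
  set I := ∫ x, |φ x| ^ p ∂μ with hI
  set J := ∫ x, ‖tgrad M.nu φ x‖ + |meanCurv M x * φ x| ∂μ with hJ
  have hI0 : 0 ≤ I := integral_nonneg fun x => by positivity
  have hJ0 : 0 ≤ J := integral_nonneg fun x => by positivity
  have hΦI : Φ = ENNReal.ofReal I := by
    rw [hI, ofReal_integral_eq_lintegral_ofReal hi1 (Filter.Eventually.of_forall fun x => by positivity)]
    refine lintegral_congr fun x => ?_
    simp only [ψ]
    rw [ENNReal.ofReal_rpow_of_nonneg (abs_nonneg _) hpp.le]
  have hQJ : Q = ENNReal.ofReal J := by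
    rw [hJ, ofReal_integral_eq_lintegral_ofReal hi2 (Filter.Eventually.of_forall fun x => by positivity)]
    refine lintegral_congr fun x => ?_
    simp only [F1, F2, ψ]
    rw [ENNReal.ofReal_add (by positivity) (by positivity), abs_mul, ENNReal.ofReal_mul (abs_nonneg _)]
  rw [hΦI, hQJ, ENNReal.ofReal_rpow_of_nonneg hI0 (by positivity), ← ENNReal.ofReal_mul (by positivity),
    ← ENNReal.ofReal_mul (by positivity), ENNReal.ofReal_le_ofReal_iff (by positivity)] at hmain
  rcases hI0.eq_or_lt with h0 | hIp
  · rw [← h0, Real.zero_rpow (by have : (n:ℝ) - 1 ≠ 0 := by linarith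
                                 positivity)]
    positivity
  · have h1 : I = I ^ (((n : ℝ) - 1) / n) * I ^ (1 / (n : ℝ)) := by
      rw [← Real.rpow_add hIp, ← add_div, sub_add_cancel, div_self (by positivity), Real.rpow_one]
    have hpos : 0 < I ^ (1 / (n : ℝ)) := by positivity
    refine le_of_mul_le_mul_right ?_ hpos
    rw [← h1]; exact hmain

lemma tgrad_zero_on {M : Hypersurface n} {u : Eu n → ℝ} (hu : Differentiable ℝ u)
    (h0 : ∀ x ∈ M.carrier, u x = 0) {ξ : Eu n} (hξ : ξ ∈ M.carrier) : tgrad M.nu u ξ = 0 := by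
  obtain ⟨L, g, V, hc⟩ := exists_chart M hξ
  have hg0 : gr L (M.nu ξ) ξ g 0 = ξ := by simp [gr, hc.zero]
  have hnu := hc.nu 0 (by rw [hg0]; exact hc.mem)
  rw [hg0] at hnu
  refine ext_inner_right ℝ fun e => ?_
  rw [tgrad_inner, inner_zero_left]
  have horth := tP_orth (M.unit_nu ξ hξ) e
  have ht := tangent_eq hc.frame g 0 (tP (M.nu ξ) e) (by rw [← hnu]; exact horth)
  rw [ht]
  have hd := hasFDerivAt_gr L (M.nu ξ) ξ (hc.cd.differentiable (by simp) 0)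
  have hcomp : HasFDerivAt (fun y => u (gr L (M.nu ξ) ξ g y))
      ((fderiv ℝ u ξ).comp (grA L (M.nu ξ) (gradient g 0))) 0 := by
    have h1 := (hu (gr L (M.nu ξ) ξ g 0)).hasFDerivAt.comp 0 hd
    rw [hg0] at h1
    exact h1
  have hz : (fun y => u (gr L (M.nu ξ) ξ g y)) =ᶠ[nhds 0] fun _ => 0 := by
    have hV : ∀ᶠ y in nhds (0 : En n), gr L (M.nu ξ) ξ g y ∈ V :=
      hd.continuousAt.eventually (by rw [hg0]; exact hc.opn.mem_nhds hc.mem)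
    filter_upwards [hV] with y hy
    exact h0 _ ((hc.iff _ hy).2 ⟨y, rfl⟩)
  have h2 := hcomp.unique ((hasFDerivAt_const (0 : ℝ) (0 : En n)).congr_of_eventuallyEq hz)
  have h3 := congrArg (fun T => T (adjL L (tP (M.nu ξ) e))) h2
  simpa using h3

lemma exists_adm {M : Hypersurface n} {φ : Eu n → ℝ} (h : C1cOn M.carrier φ) :
    ∃ u, Adm M u ∧ ∀ x ∈ M.carrier, u x = φ x := by
  obtain ⟨hcd, K, hK, hKM, h0⟩ := h
  obtain ⟨U, Z, hU, hZ, hM⟩ := locClosed M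
  have hKU : K ⊆ U := fun x hx => by
    have := hKM hx
    rw [hM] at this; exact this.1
  obtain ⟨K', hK', hKK', hK'U⟩ := exists_compact_between hK hU hKU
  obtain ⟨f, hf⟩ := SmoothPartitionOfUnity.exists_isSubordinate (modelWithCornersSelf ℝ (Eu n))
    hK.isClosed (fun _ : Unit => interior K') (fun _ => isOpen_interior) (by
      intro x hx
      exact Set.mem_iUnion.2 ⟨(), hKK' hx⟩)
  have hfc : ContDiff ℝ 1 (f ()) := (f ()).contMDiff.contDiff.of_le (by exact_mod_cast le_top)
  have hf1 : ∀ x ∈ K, f () x = 1 := fun x hx => by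
    have := f.sum_eq_one hx
    rwa [finsum_eq_sum_of_fintype, Fintype.sum_unique] at this
  have hts : tsupport (f ()) ⊆ K' := (hf ()).trans interior_subset
  have hsub : tsupport (fun x => f () x * φ x) ⊆ K' :=
    (closure_mono (fun x hx h => hx (by simp [h]) :
      Function.support (fun x => f () x * φ x) ⊆ Function.support (f ()))).trans hts
  have hcs : HasCompactSupport (fun x => f () x * φ x) :=
    hK'.of_isClosed_subset (isClosed_tsupport _) hsub
  refine ⟨fun x => f () x * φ x, ⟨hfc.mul hcd, hcs, ?_⟩, ?_⟩
  · have : M.carrier ∩ tsupport (fun x => f () x * φ x) = tsupport (fun x => f () x * φ x) ∩ Z := by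
      rw [hM]; ext x; constructor
      · rintro ⟨⟨_, h2⟩, h3⟩; exact ⟨h3, h2⟩
      · rintro ⟨h1, h2⟩; exact ⟨⟨hK'U (hsub h1), h2⟩, h1⟩
    rw [this]; exact IsCompact.inter_right hcs hZ
  · intro x hx
    by_cases hxK : x ∈ K
    · simp [hf1 x hxK]
    · simp [h0 x hx hxK]

/-- The `p = 1` Michael–Simon and Allard Sobolev inequality:
`(∫_M |φ|^{n/(n−1)})^{(n−1)/n} ≤ C(n) ∫_M (|∇_T φ| + |Hφ|)`. -/
theorem michael_simon_allard_sobolev_one (n : ℕ) (hn : 1 < n) :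
    ∃ C : ℝ, 0 < C ∧ ∀ (M : Hypersurface n) (φ : Eu n → ℝ), C1cOn M.carrier φ →
      (∫ x, |φ x| ^ ((n : ℝ) / (n - 1)) ∂surfMeasure M) ^ (((n : ℝ) - 1) / n)
        ≤ C * ∫ x, ‖tgrad M.nu φ x‖ + |meanCurv M x * φ x| ∂surfMeasure M := by
  obtain ⟨C, hC, hmain⟩ := sobolev_adm n hn
  refine ⟨C, hC, fun M φ hφ => ?_⟩
  obtain ⟨u, hu, hue⟩ := exists_adm hφ
  have h1 := hmain M u hu
  have hI : ∫ x, |φ x| ^ ((n : ℝ) / (n - 1)) ∂surfMeasure M =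
      ∫ x, |u x| ^ ((n : ℝ) / (n - 1)) ∂surfMeasure M :=
    surf_congr M fun x hx => by simp only [hue x hx]
  have hJ : ∫ x, ‖tgrad M.nu φ x‖ + |meanCurv M x * φ x| ∂surfMeasure M =
      ∫ x, ‖tgrad M.nu u x‖ + |meanCurv M x * u x| ∂surfMeasure M := by
    refine surf_congr M fun x hx => ?_
    have hud : Differentiable ℝ u := hu.cd.differentiable (by simp)
    have hφd : Differentiable ℝ φ := hφ.1.differentiable (by simp)
    have h2 := tgrad_zero_on (M := M) (u := fun x => u x - φ x) (hud.sub hφd)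
      (fun x hx => by rw [hue x hx, sub_self]) hx
    have h3 : tgrad M.nu φ x = tgrad M.nu u x := by
      refine ext_inner_right ℝ fun e => ?_
      have h4 := congrArg (fun v => ⟪v, e⟫) h2
      simp only [inner_zero_left] at h4
      rw [tgrad_inner, fderiv_fun_sub (hud x) (hφd x)] at h4
      rw [tgrad_inner, tgrad_inner]
      simp only [_root_.sub_apply] at h4
      linarith
    simp only [hue x hx, h3]
  rw [hI, hJ]
  exact h1
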